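/- arXiv:2507.09526 — 2 statements merged into one kernel-verified Lean document; each statement's English description precedes it below -/
import Mathlib

section
/- Let (V, V₊, v) and (W, W₊, w) be complete order unit spaces with open cones C := V₊° and D := W₊°, and let Φ: C → D be a gauge-reversing bijection. Then for each x ∈ C there exists a unique linear bijection A: V → W with A(V₊) = W₊ and A(x) = Φ(x) (so A is an isomorphism of order unit spaces from (V, V₊, x) onto (W, W₊, Φ(x))) such that for all y ∈ V₊ one has ‖Φ(x+y) − Φ(x) + A(y)‖_{Φ(x)} ≤ ‖y‖_x², where ‖·‖_x and ‖·‖_{Φ(x)} are the order unit norms determined by the order units x ∈ C and Φ(x) ∈ D. -/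
open scoped Topology

section Defs

/-- `(V, P, v)` is an order unit space: `P` is a proper cone, the induced order is
archimedean, `v` is an order unit, and the norm of `V` is the order unit norm. -/
structure IsOrderUnitSpace (V : Type*) [NormedAddCommGroup V] [NormedSpace ℝ V]
    (P : Set V) (v : V) : Prop where
  add_mem : ∀ x ∈ P, ∀ y ∈ P, x + y ∈ P
  smul_mem : ∀ r : ℝ, 0 ≤ r → ∀ x ∈ P, r • x ∈ P
  proper : ∀ x : V, x ∈ P → -x ∈ P → x = 0
  archimedean : ∀ x b : V, (∀ r : ℝ, 0 ≤ r → b - r • x ∈ P) → -x ∈ P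
  unit_mem : v ∈ P
  unit_order : ∀ x : V, ∃ r : ℝ, 0 < r ∧ r • v - x ∈ P
  norm_eq : ∀ x : V, ‖x‖ = sInf {r : ℝ | 0 ≤ r ∧ x + r • v ∈ P ∧ r • v - x ∈ P}

variable {V : Type*} [NormedAddCommGroup V] [NormedSpace ℝ V]
variable {W : Type*} [NormedAddCommGroup W] [NormedSpace ℝ W]

/-- The open cone (norm interior of the cone `P`) of an order unit space. -/
def openCone (P : Set V) (v : V) : Set V := {x | ∃ ε : ℝ, 0 < ε ∧ x - ε • v ∈ P}

/-- The order unit norm `‖x‖_u` determined by an order unit `u`. -/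
noncomputable def ounorm (P : Set V) (u x : V) : ℝ :=
  sInf {r : ℝ | 0 ≤ r ∧ x + r • u ∈ P ∧ r • u - x ∈ P}

/-- Thompson's metric `d_T(x,y) = log inf {r ≥ 1 : r⁻¹ y ≤ x ≤ r y}`. -/
noncomputable def thompsonDist (P : Set V) (x y : V) : ℝ :=
  Real.log (sInf {r : ℝ | 1 ≤ r ∧ x - r⁻¹ • y ∈ P ∧ r • y - x ∈ P})

/-- `Φ` is a gauge-reversing bijection from the open cone of `(V, P, v)` onto the
open cone of `(W, Q, w)`: a bijection, homogeneous of degree `-1`,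
and an order-anti-isomorphism. -/
def GaugeReversing (P : Set V) (v : V) (Q : Set W) (w : W) (Φ : V → W) : Prop :=
  Set.BijOn Φ (openCone P v) (openCone Q w) ∧
  (∀ x ∈ openCone P v, ∀ r : ℝ, 0 < r → Φ (r • x) = r⁻¹ • Φ x) ∧
  (∀ x ∈ openCone P v, ∀ y ∈ openCone P v, (y - x ∈ P ↔ Φ x - Φ y ∈ Q))

/-- `Φ` is a gauge-preserving bijection from the open cone of `(V, P, v)` onto the
open cone of `(W, Q, w)`: a bijection, homogeneous of degree `1`,
and an order-isomorphism. -/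
def GaugePreserving (P : Set V) (v : V) (Q : Set W) (w : W) (Φ : V → W) : Prop :=
  Set.BijOn Φ (openCone P v) (openCone Q w) ∧
  (∀ x ∈ openCone P v, ∀ r : ℝ, 0 < r → Φ (r • x) = r • Φ x) ∧
  (∀ x ∈ openCone P v, ∀ y ∈ openCone P v, (y - x ∈ P ↔ Φ y - Φ x ∈ Q))

/-- `mul` is a JB-algebra structure on the order unit space `(V, P, v)` with unit
element `v` and cone of squares `P`. -/
def IsJBAlgebraStructure (P : Set V) (v : V) (mul : V →ₗ[ℝ] V →ₗ[ℝ] V) : Prop :=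
  (∀ x y : V, mul x y = mul y x) ∧
  (∀ x : V, mul v x = x) ∧
  (∀ x y : V, mul x (mul y (mul x x)) = mul (mul x y) (mul x x)) ∧
  (∀ x y : V, ‖mul x y‖ ≤ ‖x‖ * ‖y‖) ∧
  (∀ x : V, ‖mul x x‖ = ‖x‖ ^ 2) ∧
  (∀ x y : V, ‖mul x x‖ ≤ ‖mul x x + mul y y‖) ∧
  P = {y : V | ∃ x : V, mul x x = y}

/-- `S` is a `d_T`-symmetry of the open cone of `(V, P, v)` at the point `p`:
an involutive `d_T`-isometry of the open cone having `p` as an isolated fixed point. -/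
def IsDTSymmetry (P : Set V) (v : V) (S : V → V) (p : V) : Prop :=
  (∀ x ∈ openCone P v, S x ∈ openCone P v) ∧
  (∀ x ∈ openCone P v, S (S x) = x) ∧
  (∀ x ∈ openCone P v, ∀ y ∈ openCone P v,
    thompsonDist P (S x) (S y) = thompsonDist P x y) ∧
  p ∈ openCone P v ∧ S p = p ∧
  (∃ ε : ℝ, 0 < ε ∧ ∀ x ∈ openCone P v, S x = x → thompsonDist P p x < ε → x = p)

/-- A complete order unit space `(W, Q, w)` together with a gauge-reversing bijection
from the open cone of `(V, P, v)` onto the open cone of `(W, Q, w)`. -/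
structure GaugeReversingTarget (V : Type*) [NormedAddCommGroup V] [NormedSpace ℝ V]
    (P : Set V) (v : V) where
  W : Type
  [instGroup : NormedAddCommGroup W]
  [instSpace : NormedSpace ℝ W]
  [instComplete : CompleteSpace W]
  Q : Set W
  w : W
  ous : IsOrderUnitSpace W Q w
  Φ : V → W
  grev : GaugeReversing P v Q w Φ

/-- The state space of the order unit space `(V, P, v)`, as a subset of the
weak-* dual of `V`. -/
def stateSpace (P : Set V) (v : V) : Set (WeakDual ℝ V) :=
  {ρ | (∀ x ∈ P, 0 ≤ ρ x) ∧ ρ v = 1}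

/-- A real-valued function on the dual is affine on `K`. -/
def AffineOnK (K : Set (WeakDual ℝ V)) (g : WeakDual ℝ V → ℝ) : Prop :=
  ∀ ρ ∈ K, ∀ σ ∈ K, ∀ t : ℝ, 0 ≤ t → t ≤ 1 →
    g ((1 - t) • ρ + t • σ) = (1 - t) * g ρ + t * g σ

/-- An extended-real-valued function on the dual is affine on `K`. -/
def AffineOnKE (K : Set (WeakDual ℝ V)) (g : WeakDual ℝ V → EReal) : Prop :=
  ∀ ρ ∈ K, ∀ σ ∈ K, ∀ t : ℝ, 0 ≤ t → t ≤ 1 →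
    g ((1 - t) • ρ + t • σ) = ((1 - t : ℝ) : EReal) * g ρ + ((t : ℝ) : EReal) * g σ

/-- Membership in the extended cone `C_usc` of nonnegative affine upper semicontinuous
functions on the state space `K`. -/
def memCusc (K : Set (WeakDual ℝ V)) (g : WeakDual ℝ V → ℝ) : Prop :=
  (∀ ρ ∈ K, 0 ≤ g ρ) ∧ AffineOnK K g ∧ UpperSemicontinuousOn g K

/-- `p` is an extremal vector of the cone `C_usc` over the state space `K`. -/
def IsExtremalCusc (K : Set (WeakDual ℝ V)) (p : WeakDual ℝ V → ℝ) : Prop :=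
  memCusc K p ∧ (∃ ρ ∈ K, p ρ ≠ 0) ∧
  ∀ x, memCusc K x → (∀ ρ ∈ K, x ρ ≤ p ρ) →
    ∃ t : ℝ, 0 ≤ t ∧ t ≤ 1 ∧ ∀ ρ ∈ K, x ρ = t * p ρ

/-- The cone `C_usc` over the state space `K` is strongly atomic: each of its
members is the least upper bound of the extremal vectors it dominates. -/
def StronglyAtomicCusc (K : Set (WeakDual ℝ V)) : Prop :=
  ∀ g, memCusc K g →
    (∀ p, IsExtremalCusc K p → (∀ ρ ∈ K, p ρ ≤ g ρ) → ∀ ρ ∈ K, p ρ ≤ g ρ) ∧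
    (∀ h, memCusc K h →
      (∀ p, IsExtremalCusc K p → (∀ ρ ∈ K, p ρ ≤ g ρ) → ∀ ρ ∈ K, p ρ ≤ h ρ) →
      ∀ ρ ∈ K, g ρ ≤ h ρ)

end Defs

namespace IsOrderUnitSpace

variable {V : Type*} [NormedAddCommGroup V] [NormedSpace ℝ V] {P : Set V} {v : V}

lemma zero_mem (hV : IsOrderUnitSpace V P v) : (0 : V) ∈ P := by
  simpa using hV.smul_mem 0 le_rfl v hV.unit_mem

lemma sub_trans (hV : IsOrderUnitSpace V P v) {a b c : V} (hab : b - a ∈ P) (hbc : c - b ∈ P) :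
    c - a ∈ P := by
  simpa using hV.add_mem _ hbc _ hab

lemma eq_of_sub_mem (hV : IsOrderUnitSpace V P v) {a b : V} (hab : b - a ∈ P) (hba : a - b ∈ P) :
    a = b :=
  sub_eq_zero.1 (hV.proper _ hba (by simpa using hab))

lemma mem_of_smul_mem (hV : IsOrderUnitSpace V P v) {r : ℝ} (hr : 0 < r) {a : V}
    (h : r • a ∈ P) : a ∈ P := by
  simpa [smul_smul, hr.ne'] using hV.smul_mem r⁻¹ (inv_nonneg.2 hr.le) _ h

lemma mem_of_forall_add_smul_mem (hV : IsOrderUnitSpace V P v) {a b : V} (hb : b ∈ P)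
    (h : ∀ ε : ℝ, 0 < ε → ε ≤ 1 → a + ε • b ∈ P) : a ∈ P := by
  have key : ∀ ε : ℝ, 0 < ε → a + ε • b ∈ P := by
    intro ε hε
    rcases le_total ε 1 with h1 | h1
    · exact h ε hε h1
    · convert hV.add_mem _ (h 1 one_pos le_rfl) _ (hV.smul_mem (ε - 1) (by linarith) b hb) using 1
      module
  rw [← neg_neg a]
  refine hV.archimedean (-a) b fun r hr => ?_
  rcases hr.eq_or_lt with rfl | hr
  · simpa using hb
  · convert hV.smul_mem r hr.le _ (key r⁻¹ (inv_pos.2 hr)) using 1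
    rw [smul_add, smul_smul, mul_inv_cancel₀ hr.ne']
    module

lemma mem_of_mem_openCone (hV : IsOrderUnitSpace V P v) {x : V} (hx : x ∈ openCone P v) :
    x ∈ P := by
  obtain ⟨ε, hε, h⟩ := hx
  simpa using hV.add_mem _ h _ (hV.smul_mem ε hε.le v hV.unit_mem)

lemma mem_openCone_of_sub_mem (hV : IsOrderUnitSpace V P v) {x y : V} (hx : x ∈ openCone P v)
    (h : y - x ∈ P) : y ∈ openCone P v := by
  obtain ⟨ε, hε, h'⟩ := hx
  exact ⟨ε, hε, hV.sub_trans h' h⟩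

lemma smul_mem_openCone (hV : IsOrderUnitSpace V P v) {x : V} (hx : x ∈ openCone P v) {r : ℝ}
    (hr : 0 < r) : r • x ∈ openCone P v := by
  obtain ⟨ε, hε, h⟩ := hx
  refine ⟨r * ε, by positivity, ?_⟩
  convert hV.smul_mem r hr.le _ h using 1
  module

lemma add_mem_openCone (hV : IsOrderUnitSpace V P v) {x y : V} (hx : x ∈ openCone P v)
    (hy : y ∈ P) : x + y ∈ openCone P v :=
  hV.mem_openCone_of_sub_mem hx (by simpa using hy)

lemma unit_mem_openCone (hV : IsOrderUnitSpace V P v) : v ∈ openCone P v :=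
  ⟨1, one_pos, by simpa using hV.zero_mem⟩

lemma exists_smul_sub_mem (hV : IsOrderUnitSpace V P v) {x : V} (hx : x ∈ openCone P v) (a : V) :
    ∃ r : ℝ, 0 < r ∧ r • x - a ∈ P := by
  obtain ⟨ε, hε, h⟩ := hx
  obtain ⟨r, hr, h'⟩ := hV.unit_order a
  refine ⟨r / ε, by positivity, ?_⟩
  convert hV.add_mem _ (hV.smul_mem (r / ε) (by positivity) _ h) _ h' using 1
  rw [smul_sub, smul_smul, div_mul_cancel₀ _ hε.ne']
  module

lemma exists_eq_sub (hV : IsOrderUnitSpace V P v) (a : V) :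
    ∃ p ∈ openCone P v, ∃ q ∈ openCone P v, a = p - q := by
  obtain ⟨r, hr, h⟩ := hV.unit_order (-a)
  refine ⟨a + r • v + v, ?_, r • v + v, ?_, by module⟩
  · rw [add_comm]
    exact hV.add_mem_openCone hV.unit_mem_openCone (by simpa [add_comm] using h)
  · rw [add_comm]
    exact hV.add_mem_openCone hV.unit_mem_openCone (hV.smul_mem r hr.le v hV.unit_mem)

lemma ounorm_nonneg (P : Set V) (x a : V) : 0 ≤ ounorm P x a :=
  Real.sInf_nonneg fun _ h => h.1

lemma ounorm_le {x a : V} {r : ℝ} (hr : 0 ≤ r) (h₁ : a + r • x ∈ P) (h₂ : r • x - a ∈ P) :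
    ounorm P x a ≤ r :=
  csInf_le ⟨0, fun _ h => h.1⟩ ⟨hr, h₁, h₂⟩

lemma mem_of_ounorm_le (hV : IsOrderUnitSpace V P v) {x : V} (hx : x ∈ openCone P v) {a : V}
    {r : ℝ} (h : ounorm P x a ≤ r) : a + r • x ∈ P ∧ r • x - a ∈ P := by
  have hxP := hV.mem_of_mem_openCone hx
  have hne : {r : ℝ | 0 ≤ r ∧ a + r • x ∈ P ∧ r • x - a ∈ P}.Nonempty := by
    obtain ⟨s, hs, h₁⟩ := hV.exists_smul_sub_mem hx a
    obtain ⟨t, ht, h₂⟩ := hV.exists_smul_sub_mem hx (-a)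
    refine ⟨s + t, by positivity, ?_, ?_⟩
    · convert hV.add_mem _ h₂ _ (hV.smul_mem s hs.le x hxP) using 1
      module
    · convert hV.add_mem _ h₁ _ (hV.smul_mem t ht.le x hxP) using 1
      module
  have key : ∀ ε : ℝ, 0 < ε → a + r • x + ε • x ∈ P ∧ r • x - a + ε • x ∈ P := by
    intro ε hε
    obtain ⟨s, ⟨-, h₁, h₂⟩, hs⟩ := exists_lt_of_csInf_lt hne (lt_of_le_of_lt h (by linarith :
      r < r + ε))
    have hm := hV.smul_mem (r + ε - s) (by linarith) x hxP
    constructor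
    · convert hV.add_mem _ h₁ _ hm using 1
      module
    · convert hV.add_mem _ h₂ _ hm using 1
      module
  exact ⟨hV.mem_of_forall_add_smul_mem hxP fun ε hε _ => (key ε hε).1,
    hV.mem_of_forall_add_smul_mem hxP fun ε hε _ => (key ε hε).2⟩

end IsOrderUnitSpace

/-- Linear programming duality for the value function `a ↦ inf {c r | R a r}` of a conical
constraint `R`: the value function is sublinear, so it has a linear minorant touching it at
a given point. -/
lemma exists_linear_le_value {E F : Type*} [AddCommGroup E] [Module ℝ E] [AddCommGroup F]
    [Module ℝ F] (R : E → F → Prop) (c : F →ₗ[ℝ] ℝ)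
    (hadd : ∀ a b r s, R a r → R b s → R (a + b) (r + s))
    (hsmul : ∀ t : ℝ, 0 < t → ∀ a r, R a r → R (t • a) (t • r))
    (hne : ∀ a, ∃ r, R a r) (hbdd : ∀ a, ∃ m, ∀ r, R a r → m ≤ c r) (hzero : R 0 0) (a₀ : E) :
    ∃ L : E →ₗ[ℝ] ℝ, (∀ a r, R a r → L a ≤ c r) ∧
      ∀ m, (∀ r, R a₀ r → m ≤ c r) → m ≤ L a₀ := by
  set N : E → ℝ := fun a => sInf (c '' {r | R a r}) with hN
  have hbelow : ∀ a, BddBelow (c '' {r | R a r}) := fun a => by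
    obtain ⟨m, hm⟩ := hbdd a
    exact ⟨m, by rintro _ ⟨r, hr, rfl⟩; exact hm r hr⟩
  have hnonempty : ∀ a, (c '' {r | R a r}).Nonempty := fun a =>
    (hne a).elim fun r hr => ⟨_, r, hr, rfl⟩
  have hle : ∀ a r, R a r → N a ≤ c r := fun a r hr => csInf_le (hbelow a) ⟨r, hr, rfl⟩
  have hge : ∀ a m, (∀ r, R a r → m ≤ c r) → m ≤ N a := fun a m hm =>
    le_csInf (hnonempty a) (by rintro _ ⟨r, hr, rfl⟩; exact hm r hr)
  have hNadd : ∀ a b, N (a + b) ≤ N a + N b := by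
    intro a b
    have h : N (a + b) - N b ≤ N a := hge _ _ fun r hr => by
      have : N (a + b) - c r ≤ N b := hge _ _ fun s hs => by
        have := hle _ _ (hadd _ _ _ _ hr hs)
        rw [map_add] at this
        linarith
      linarith
    linarith
  have hNle : ∀ t : ℝ, 0 < t → ∀ a, N (t • a) ≤ t * N a := by
    intro t ht a
    have h : t⁻¹ * N (t • a) ≤ N a := hge _ _ fun r hr => by
      have := hle _ _ (hsmul t ht _ _ hr)
      rw [map_smul, smul_eq_mul] at this
      rw [inv_mul_le_iff₀ ht]
      exact this
    rwa [inv_mul_le_iff₀ ht] at h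
  have hNsmul : ∀ t : ℝ, 0 < t → ∀ a, N (t • a) = t * N a := by
    intro t ht a
    refine le_antisymm (hNle t ht a) ?_
    have := hNle t⁻¹ (inv_pos.2 ht) (t • a)
    rwa [smul_smul, inv_mul_cancel₀ ht.ne', one_smul, le_inv_mul_iff₀ ht] at this
  have hN0 : N 0 = 0 := by
    have h := hNsmul 2 two_pos 0
    rw [smul_zero] at h
    linarith
  have hneg : ∀ a, -N (-a) ≤ N a := fun a => by
    have := hNadd a (-a)
    rw [add_neg_cancel, hN0] at this
    linarith
  rcases eq_or_ne a₀ 0 with rfl | ha₀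
  · obtain ⟨L, -, hL⟩ := exists_extension_of_le_sublinear (E := E) ⟨⊥, 0⟩ N hNsmul hNadd
      (fun x => by
        have : (x : E) = 0 := (Submodule.mem_bot ℝ).1 x.2
        simp [this, hN0])
    refine ⟨L, fun a r hr => (hL a).trans (hle a r hr), fun m hm => ?_⟩
    simpa using hm 0 hzero
  · obtain ⟨L, hL₁, hL₂⟩ := exists_extension_of_le_sublinear (E := E)
      (LinearPMap.mkSpanSingleton a₀ (N a₀) ha₀) N hNsmul hNadd (by
        rintro ⟨x, hx⟩
        obtain ⟨t, rfl⟩ := Submodule.mem_span_singleton.1 hx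
        rw [LinearPMap.mkSpanSingleton'_apply, RingHom.id_apply, smul_eq_mul]
        rcases lt_trichotomy t 0 with ht | rfl | ht
        · have h₁ := hNsmul (-t) (by linarith) (-a₀)
          have h₂ := mul_le_mul_of_nonneg_left (hneg a₀) (by linarith : 0 ≤ -t)
          simp only [smul_neg, neg_smul, neg_neg] at h₁
          rw [h₁]
          linarith
        · simp [hN0]
        · exact (hNsmul t ht a₀).ge)
    refine ⟨L, fun a r hr => (hL₂ a).trans (hle a r hr), fun m hm => ?_⟩
    rw [show L a₀ = N a₀ from (hL₁ ⟨a₀, Submodule.mem_span_singleton_self a₀⟩).trans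
      (LinearPMap.mkSpanSingleton'_apply_self a₀ (N a₀) _ _)]
    exact hge _ _ hm

/-- A state `ψ` of an order unit space `(V, P, v)` whose strict sublevel sets are directed
upwards. -/
structure IsDirectedState {V : Type*} [NormedAddCommGroup V] [NormedSpace ℝ V]
    (P : Set V) (v : V) (ψ : V →ₗ[ℝ] ℝ) : Prop where
  nonneg : ∀ a ∈ P, 0 ≤ ψ a
  map_unit : ψ v = 1
  directed : ∀ a b : V, ∀ d : ℝ, ψ a < d → ψ b < d → ∃ r, r - a ∈ P ∧ r - b ∈ P ∧ ψ r < d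

lemma IsDirectedState.mono {V : Type*} [NormedAddCommGroup V] [NormedSpace ℝ V]
    {P : Set V} {v : V} {ψ : V →ₗ[ℝ] ℝ} (hψ : IsDirectedState P v ψ) {a b : V} (h : b - a ∈ P) :
    ψ a ≤ ψ b := by
  have := hψ.nonneg _ h
  rw [map_sub] at this
  linarith

lemma IsDirectedState.pos {V : Type*} [NormedAddCommGroup V] [NormedSpace ℝ V]
    {P : Set V} {v : V} {ψ : V →ₗ[ℝ] ℝ} (hψ : IsDirectedState P v ψ) {a : V}
    (h : a ∈ openCone P v) : 0 < ψ a := by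
  obtain ⟨ε, hε, h⟩ := h
  have := hψ.mono h
  rw [map_smul, hψ.map_unit, smul_eq_mul, mul_one] at this
  linarith

/-- The state space of `(V, P, v)`, as a set of functions on `V`. -/
def stateFunctions {V : Type*} [NormedAddCommGroup V] [NormedSpace ℝ V] (P : Set V) (v : V) :
    Set (V → ℝ) :=
  {f | (∀ a b, f (a + b) = f a + f b) ∧ (∀ (t : ℝ) a, f (t • a) = t * f a) ∧
    (∀ a ∈ P, 0 ≤ f a) ∧ f v = 1}

namespace IsOrderUnitSpace

variable {V : Type*} [NormedAddCommGroup V] [NormedSpace ℝ V] {P : Set V} {v : V}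

lemma isCompact_stateFunctions (hV : IsOrderUnitSpace V P v) :
    IsCompact (stateFunctions P v) := by
  choose r hr hrP using hV.unit_order
  refine (isCompact_univ_pi fun a : V => isCompact_Icc (a := -r (-a)) (b := r a)).of_isClosed_subset
    ?_ ?_
  · have h₁ : IsClosed {f : V → ℝ | ∀ a b, f (a + b) = f a + f b} := by
      simp only [Set.ofPred_forall]
      exact isClosed_iInter fun a => isClosed_iInter fun b =>
        isClosed_eq (by fun_prop) (by fun_prop)
    have h₂ : IsClosed {f : V → ℝ | ∀ (t : ℝ) a, f (t • a) = t * f a} := by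
      simp only [Set.ofPred_forall]
      exact isClosed_iInter fun a => isClosed_iInter fun b =>
        isClosed_eq (by fun_prop) (by fun_prop)
    have h₃ : IsClosed {f : V → ℝ | ∀ a ∈ P, 0 ≤ f a} := by
      simp only [Set.ofPred_forall]
      exact isClosed_iInter fun a => isClosed_iInter fun _ =>
        isClosed_le (by fun_prop) (by fun_prop)
    have h₄ : IsClosed {f : V → ℝ | f v = 1} := isClosed_eq (by fun_prop) (by fun_prop)
    exact h₁.inter (h₂.inter (h₃.inter h₄))
  · rintro f ⟨hadd, hsmul, hpos, hv⟩ a -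
    have key : ∀ b, f b ≤ r b := fun b => by
      have h := hpos _ (hrP b)
      rw [sub_eq_add_neg, hadd, hsmul, hv, ← neg_one_smul ℝ b, hsmul] at h
      linarith
    have h := key (-a)
    rw [← neg_one_smul ℝ a, hsmul, neg_one_smul] at h
    exact ⟨by linarith, key a⟩

lemma exists_stateFunctions_neg (hV : IsOrderUnitSpace V P v) {z : V} (hz : z ∉ P) :
    ∃ f ∈ stateFunctions P v, f z < 0 := by
  obtain ⟨L, hL, hLz⟩ := exists_linear_le_value (fun (a : V) (t : ℝ) => t • v - a ∈ P)
    (LinearMap.id : ℝ →ₗ[ℝ] ℝ)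
    (fun a b r s hr hs => by
      convert hV.add_mem _ hr _ hs using 1
      module)
    (fun t ht a r hr => by
      convert hV.smul_mem t ht.le _ hr using 1
      rw [smul_eq_mul]
      module)
    (fun a => (hV.unit_order a).imp fun r h => h.2)
    (fun a => by
      by_contra! h
      have hv : -v ∈ P := hV.archimedean v (-a) fun r _ => by
        obtain ⟨s, hs, hsr⟩ := h (-r)
        convert hV.add_mem _ hs _ (hV.smul_mem (-r - s) (sub_nonneg.2 hsr.le) v hV.unit_mem)
          using 1
        module
      have hv0 := hV.proper v hV.unit_mem hv
      obtain ⟨s, hs⟩ := hV.unit_order (-z)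
      exact hz (by simpa [hv0] using hs.2))
    (by simpa using hV.zero_mem) (-z)
  have hpos : ∀ a ∈ P, 0 ≤ L a := fun a ha => by
    have := hL (-a) 0 (by simpa using ha)
    simpa using this
  have hv₁ : L v ≤ 1 := by simpa using hL v 1 (by simpa using hV.zero_mem)
  have hv₂ : L (-v) ≤ -1 := by simpa using hL (-v) (-1) (by simpa using hV.zero_mem)
  rw [map_neg] at hv₂
  refine ⟨L, ⟨map_add L, fun t a => by simp, hpos, by linarith⟩, ?_⟩
  obtain ⟨ε, hε, h⟩ : ∃ ε : ℝ, 0 < ε ∧ ∀ t : ℝ, t • v - -z ∈ P → ε ≤ t := by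
    by_contra! h
    refine hz (hV.mem_of_forall_add_smul_mem hV.unit_mem fun ε hε _ => ?_)
    obtain ⟨t, ht, htε⟩ := h ε hε
    convert hV.add_mem _ ht _ (hV.smul_mem (ε - t) (sub_nonneg.2 htε.le) v hV.unit_mem) using 1
    module
  have := hLz ε h
  rw [map_neg] at this
  linarith

/-- A positive functional dominated by an extreme state is a multiple of it. -/
lemma eq_smul_of_mem_extremePoints (hV : IsOrderUnitSpace V P v) {ψ ψ₁ ψ₂ : V →ₗ[ℝ] ℝ}
    (hψ : ⇑ψ ∈ (stateFunctions P v).extremePoints ℝ) (h₁ : ∀ a ∈ P, 0 ≤ ψ₁ a)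
    (h₂ : ∀ a ∈ P, 0 ≤ ψ₂ a) (hsum : ∀ a, ψ₁ a + ψ₂ a = ψ a) (a : V) :
    ψ₁ a = ψ₁ v * ψ a := by
  have hzero : ∀ φ : V →ₗ[ℝ] ℝ, (∀ a ∈ P, 0 ≤ φ a) → φ v = 0 → ∀ a, φ a = 0 := by
    intro φ hφ hφv
    have hle : ∀ a, φ a ≤ 0 := fun a => by
      obtain ⟨r, -, h⟩ := hV.unit_order a
      simpa [hφv] using hφ _ h
    intro a
    have := hle (-a)
    rw [map_neg] at this
    linarith [hle a]
  have hstate : ∀ φ : V →ₗ[ℝ] ℝ, (∀ a ∈ P, 0 ≤ φ a) → 0 < φ v →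
      (fun a => (φ v)⁻¹ * φ a) ∈ stateFunctions P v := fun φ hφ hφv =>
    ⟨fun a b => by simp [mul_add], fun t a => by simp [mul_left_comm],
      fun a ha => mul_nonneg (inv_nonneg.2 hφv.le) (hφ a ha), inv_mul_cancel₀ hφv.ne'⟩
  have hv : ψ₁ v + ψ₂ v = 1 := (hsum v).trans hψ.1.2.2.2
  rcases (h₁ v hV.unit_mem).eq_or_lt with hv₁ | hv₁
  · rw [hzero ψ₁ h₁ hv₁.symm a, ← hv₁, zero_mul]
  rcases (h₂ v hV.unit_mem).eq_or_lt with hv₂ | hv₂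
  · have := hsum a
    rw [hzero ψ₂ h₂ hv₂.symm a] at this
    rw [← hv₂] at hv
    rw [show ψ₁ v = 1 by linarith]
    linarith
  have hseg : ⇑ψ ∈ openSegment ℝ (fun a => (ψ₁ v)⁻¹ * ψ₁ a) (fun a => (ψ₂ v)⁻¹ * ψ₂ a) := by
    refine ⟨ψ₁ v, ψ₂ v, hv₁, hv₂, hv, funext fun b => ?_⟩
    simp [hv₁.ne', hv₂.ne', hsum]
  have := congrFun (hψ.2 (hstate ψ₁ h₁ hv₁) (hstate ψ₂ h₂ hv₂) hseg) a
  rw [← this, mul_inv_cancel_left₀ hv₁.ne']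

lemma isDirectedState_of_mem_extremePoints (hV : IsOrderUnitSpace V P v) {ψ : V →ₗ[ℝ] ℝ}
    (hψ : ⇑ψ ∈ (stateFunctions P v).extremePoints ℝ) : IsDirectedState P v ψ := by
  obtain ⟨-, -, hpos, hv⟩ := hψ.1
  have hmono : ∀ {a b : V}, b - a ∈ P → ψ a ≤ ψ b := fun {a b} h => by
    have := hpos _ h
    rw [map_sub] at this
    linarith
  refine ⟨hpos, hv, fun a b d ha hb => ?_⟩
  by_contra! h
  obtain ⟨L, hL, hLd⟩ := exists_linear_le_value
    (fun (p : V × V) (r : V) => r - p.1 ∈ P ∧ r - p.2 ∈ P) ψ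
    (fun p q r s hr hs => ⟨by
      convert hV.add_mem _ hr.1 _ hs.1 using 1
      simp only [Prod.fst_add]
      module, by
      convert hV.add_mem _ hr.2 _ hs.2 using 1
      simp only [Prod.snd_add]
      module⟩)
    (fun t ht p r hr => ⟨by
      simpa [smul_sub] using hV.smul_mem t ht.le _ hr.1, by
      simpa [smul_sub] using hV.smul_mem t ht.le _ hr.2⟩)
    (fun p => by
      obtain ⟨s, hs, h₁⟩ := hV.unit_order p.1
      obtain ⟨t, ht, h₂⟩ := hV.unit_order p.2
      refine ⟨(s + t) • v, ?_, ?_⟩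
      · convert hV.add_mem _ h₁ _ (hV.smul_mem t ht.le v hV.unit_mem) using 1
        module
      · convert hV.add_mem _ h₂ _ (hV.smul_mem s hs.le v hV.unit_mem) using 1
        module)
    (fun p => ⟨ψ p.1, fun r hr => hmono hr.1⟩)
    (by simpa using hV.zero_mem) (a, b)
  have hL' : ∀ a b : V, L (a, b) = (L ∘ₗ LinearMap.inl ℝ V V) a + (L ∘ₗ LinearMap.inr ℝ V V) b :=
    fun a b => by simp [← map_add]
  have h₁ : ∀ a ∈ P, 0 ≤ (L ∘ₗ LinearMap.inl ℝ V V) a := fun a ha => by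
    have := hL (-a, 0) 0 (by simpa [ha] using hV.zero_mem)
    rwa [hL', map_zero, map_zero, add_zero, map_neg, neg_nonpos] at this
  have h₂ : ∀ a ∈ P, 0 ≤ (L ∘ₗ LinearMap.inr ℝ V V) a := fun a ha => by
    have := hL (0, -a) 0 (by simpa [ha] using hV.zero_mem)
    rwa [hL', map_zero, map_zero, zero_add, map_neg, neg_nonpos] at this
  have hle : ∀ a, (L ∘ₗ LinearMap.inl ℝ V V) a + (L ∘ₗ LinearMap.inr ℝ V V) a ≤ ψ a := fun a => by
    rw [← hL']
    exact hL _ _ ⟨by simpa using hV.zero_mem, by simpa using hV.zero_mem⟩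
  have hsum : ∀ a, (L ∘ₗ LinearMap.inl ℝ V V) a + (L ∘ₗ LinearMap.inr ℝ V V) a = ψ a :=
    fun a => le_antisymm (hle a) (by
      have := hle (-a)
      rw [map_neg, map_neg, map_neg] at this
      linarith)
  have ea := hV.eq_smul_of_mem_extremePoints hψ h₁ h₂ hsum a
  have eb := hV.eq_smul_of_mem_extremePoints hψ h₂ h₁ (fun a => (add_comm _ _).trans (hsum a)) b
  have hd := hLd d fun r hr => h r hr.1 hr.2
  rw [hL', ea, eb] at hd
  have hs := (hsum v).trans hv
  have n₁ := h₁ v hV.unit_mem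
  have n₂ := h₂ v hV.unit_mem
  set s := (L ∘ₗ LinearMap.inl ℝ V V) v
  set t := (L ∘ₗ LinearMap.inr ℝ V V) v
  have : s * ψ a + t * ψ b < d := by
    calc s * ψ a + t * ψ b ≤ s * max (ψ a) (ψ b) + t * max (ψ a) (ψ b) := by
          gcongr
          · exact le_max_left _ _
          · exact le_max_right _ _
      _ = max (ψ a) (ψ b) := by rw [← add_mul, hs, one_mul]
      _ < d := max_lt ha hb
  linarith

/-- The directed states determine the order of an order unit space. -/
lemma mem_of_forall_isDirectedState (hV : IsOrderUnitSpace V P v) {z : V}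
    (h : ∀ ψ : V →ₗ[ℝ] ℝ, IsDirectedState P v ψ → 0 ≤ ψ z) : z ∈ P := by
  by_contra hz
  obtain ⟨f, hf, hfz⟩ := hV.exists_stateFunctions_neg hz
  have hcont : Continuous fun f : V → ℝ => f z := by fun_prop
  obtain ⟨g, hg, hgmin⟩ := hV.isCompact_stateFunctions.exists_isMinOn ⟨f, hf⟩ hcont.continuousOn
  have hF : IsCompact (stateFunctions P v ∩ {k | k z ≤ g z}) :=
    hV.isCompact_stateFunctions.inter_right (isClosed_le hcont continuous_const)
  obtain ⟨e, he⟩ := hF.extremePoints_nonempty ⟨g, hg, le_refl (g z)⟩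
  have hext : e ∈ (stateFunctions P v).extremePoints ℝ := by
    refine ⟨he.1.1, fun k hk l hl hkl => ?_⟩
    have hgk : g z ≤ k z := hgmin hk
    have hgl : g z ≤ l z := hgmin hl
    obtain ⟨s, t, hs, ht, hst, rfl⟩ := hkl
    have hz : s * k z + t * l z ≤ g z := he.1.2
    have hg' : s * g z + t * g z = g z := by rw [← add_mul, hst, one_mul]
    refine he.2 ⟨hk, ?_⟩ ⟨hl, ?_⟩ ⟨s, t, hs, ht, hst, rfl⟩
    · refine le_of_mul_le_mul_left (?_ : s * k z ≤ s * g z) hs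
      have := mul_le_mul_of_nonneg_left hgl ht.le
      linarith
    · refine le_of_mul_le_mul_left (?_ : t * l z ≤ t * g z) ht
      have := mul_le_mul_of_nonneg_left hgk hs.le
      linarith
  obtain ⟨hadd, hsmul, -, -⟩ := he.1.1
  let ψ : V →ₗ[ℝ] ℝ := ⟨⟨e, hadd⟩, hsmul⟩
  have h0 : 0 ≤ e z := h ψ (hV.isDirectedState_of_mem_extremePoints (ψ := ψ) hext)
  have h1 : e z ≤ g z := he.1.2
  have h2 : g z ≤ f z := hgmin hf
  linarith

lemma eq_of_forall_isDirectedState (hV : IsOrderUnitSpace V P v) {a b : V}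
    (h : ∀ ψ : V →ₗ[ℝ] ℝ, IsDirectedState P v ψ → ψ a = ψ b) : a = b :=
  hV.eq_of_sub_mem (hV.mem_of_forall_isDirectedState fun ψ hψ => by simp [h ψ hψ])
    (hV.mem_of_forall_isDirectedState fun ψ hψ => by simp [h ψ hψ])

end IsOrderUnitSpace

section OrderMaps

variable {V : Type*} [NormedAddCommGroup V] [NormedSpace ℝ V] {P : Set V} {v : V}
variable {W : Type*} [NormedAddCommGroup W] [NormedSpace ℝ W] {Q : Set W} {w : W}

lemma IsDirectedState.le_of_map_lt {ψ : V →ₗ[ℝ] ℝ} (hV : IsOrderUnitSpace V P v)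
    (hψ : IsDirectedState P v ψ) {S : V → V}
    (hmono : ∀ a ∈ openCone P v, ∀ b ∈ openCone P v, (b - a ∈ P ↔ S b - S a ∈ P))
    (hle : ∀ a ∈ openCone P v, S a - a ∈ P) {a b : V} (ha : a ∈ openCone P v)
    (hb : b ∈ openCone P v) (h : ψ (S a) < ψ (S b)) : ψ a ≤ ψ b := by
  by_contra! hlt
  obtain ⟨n, hn⟩ := exists_nat_gt ((ψ (S b) - ψ a) / (ψ (S b) - ψ (S a)))
  rw [div_lt_iff₀ (by linarith)] at hn
  obtain ⟨r, hr₁, hr₂, hr₃⟩ := hψ.directed b (S b - ((n : ℝ) + 1) • (S b - S a)) (ψ a) hlt (by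
    simp only [map_sub, map_smul, smul_eq_mul]
    nlinarith)
  have hr := hV.mem_openCone_of_sub_mem hb hr₁
  have hSr₁ := (hmono b hb r hr).1 hr₁
  have hSr₂ := hV.sub_trans hr₂ (hle r hr)
  have hSr : S r - S a ∈ P := by
    refine hV.mem_of_smul_mem (r := (n : ℝ) + 1) (by positivity) ?_
    convert hV.add_mem _ (hV.smul_mem n (by positivity) _ hSr₁) _ hSr₂ using 1
    module
  have := hψ.mono ((hmono a ha r hr).2 hSr)
  linarith

/-- An order embedding of the open cone into itself that lies above the identity and is a
homothety on the ray through one point is a homothety. -/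
lemma IsOrderUnitSpace.eq_smul_of_ray (hV : IsOrderUnitSpace V P v) {S : V → V}
    (hmono : ∀ a ∈ openCone P v, ∀ b ∈ openCone P v, (b - a ∈ P ↔ S b - S a ∈ P))
    (hle : ∀ a ∈ openCone P v, S a - a ∈ P) {x : V} (hx : x ∈ openCone P v) {κ : ℝ} (hκ : 0 < κ)
    (hray : ∀ t : ℝ, 0 < t → S (t • x) = (κ * t) • x) {a : V} (ha : a ∈ openCone P v) :
    S a = κ • a := by
  refine hV.eq_of_forall_isDirectedState fun ψ hψ => ?_
  have hψx := hψ.pos hx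
  have hψa := hψ.pos ha
  have hval : ∀ t : ℝ, 0 < t → ψ (S (t • x)) = κ * (t * ψ x) := fun t ht => by
    rw [hray t ht, map_smul, smul_eq_mul, mul_assoc]
  rw [map_smul, smul_eq_mul]
  refine le_antisymm ?_ ?_
  · by_contra! h
    have ht : 0 < ψ (S a) / κ / ψ x := by
      have := (mul_pos hκ hψa).trans h
      positivity
    obtain ⟨m, hm₁, hm₂⟩ := exists_between ((lt_div_iff₀' hκ).2 h)
    have hm : 0 < m / ψ x := div_pos (hψa.trans hm₁) hψx
    have h' := hψ.le_of_map_lt hV hmono hle (hV.smul_mem_openCone hx hm) ha (by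
      rw [hval _ hm, div_mul_cancel₀ _ hψx.ne']
      exact (lt_div_iff₀' hκ).1 hm₂)
    rw [map_smul, smul_eq_mul, div_mul_cancel₀ _ hψx.ne'] at h'
    linarith
  · by_contra! h
    obtain ⟨m, hm₁, hm₂⟩ := exists_between (max_lt ((div_lt_iff₀' hκ).2 h) hψa)
    have hm : 0 < m / ψ x := div_pos ((le_max_right _ _).trans_lt hm₁) hψx
    have h' := hψ.le_of_map_lt hV hmono hle ha (hV.smul_mem_openCone hx hm) (by
      rw [hval _ hm, div_mul_cancel₀ _ hψx.ne']
      exact (div_lt_iff₀' hκ).1 ((le_max_left _ _).trans_lt hm₁))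
    rw [map_smul, smul_eq_mul, div_mul_cancel₀ _ hψx.ne'] at h'
    linarith

lemma GaugePreserving.invFunOn {A : V → W} (hA : GaugePreserving P v Q w A)
    (hV : IsOrderUnitSpace V P v) :
    GaugePreserving Q w P v (Function.invFunOn A (openCone P v)) := by
  obtain ⟨hbij, hhom, hord⟩ := hA
  have hmem : ∀ b ∈ openCone Q w, Function.invFunOn A (openCone P v) b ∈ openCone P v :=
    fun b hb => Function.invFunOn_mem (hbij.surjOn hb)
  have heq : ∀ b ∈ openCone Q w, A (Function.invFunOn A (openCone P v) b) = b :=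
    fun b hb => Function.invFunOn_eq (hbij.surjOn hb)
  refine ⟨hbij.symm (Set.BijOn.invOn_invFunOn hbij).symm, fun b hb r hr => ?_,
    fun a ha b hb => ?_⟩
  · have h := hhom _ (hmem b hb) r hr
    rw [heq b hb] at h
    rw [← h, (Set.BijOn.invOn_invFunOn hbij).1 (hV.smul_mem_openCone (hmem b hb) hr)]
  · rw [hord _ (hmem a ha) _ (hmem b hb), heq a ha, heq b hb]

lemma GaugePreserving.add_le (hV : IsOrderUnitSpace V P v) (hW : IsOrderUnitSpace W Q w)
    {A : V → W} (hA : GaugePreserving P v Q w A) {a b : V} (ha : a ∈ openCone P v)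
    (hb : b ∈ openCone P v) : A a + A b - A (a + b) ∈ Q := by
  obtain ⟨hbij, hhom, hord⟩ := hA
  refine hW.mem_of_forall_isDirectedState fun φ hφ => ?_
  have hα := hφ.pos (hbij.mapsTo ha)
  have hβ := hφ.pos (hbij.mapsTo hb)
  rw [map_sub, map_add, sub_nonneg]
  set α := φ (A a) with hα'
  set β := φ (A b) with hβ'
  have key : ∀ d : ℝ, 1 < d → φ (A (a + b)) ≤ (α + β) * d := by
    intro d hd
    obtain ⟨r, hr₁, hr₂, hr₃⟩ := hφ.directed (α⁻¹ • A a) (β⁻¹ • A b) d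
      (by rwa [map_smul, smul_eq_mul, ← hα', inv_mul_cancel₀ hα.ne'])
      (by rwa [map_smul, smul_eq_mul, ← hβ', inv_mul_cancel₀ hβ.ne'])
    have hr := hW.mem_openCone_of_sub_mem
      (hW.smul_mem_openCone (hbij.mapsTo ha) (inv_pos.2 hα)) hr₁
    obtain ⟨z, hz, rfl⟩ := hbij.surjOn hr
    have hbound : ∀ c ∈ openCone P v, ∀ γ : ℝ, 0 < γ → A z - γ⁻¹ • A c ∈ Q →
        γ • z - c ∈ P := by
      intro c hc γ hγ h
      rw [hord _ hc _ (hV.smul_mem_openCone hz hγ), hhom _ hz _ hγ]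
      convert hW.smul_mem γ hγ.le _ h using 1
      rw [smul_sub, smul_inv_smul₀ hγ.ne']
    have hsum : (α + β) • z - (a + b) ∈ P := by
      convert hV.add_mem _ (hbound a ha α hα hr₁) _ (hbound b hb β hβ hr₂) using 1
      module
    have hab : a + b ∈ openCone P v := hV.add_mem_openCone ha (hV.mem_of_mem_openCone hb)
    rw [hord _ hab _ (hV.smul_mem_openCone hz (add_pos hα hβ)), hhom _ hz _ (add_pos hα hβ)] at hsum
    have := hφ.mono hsum
    rw [map_smul, smul_eq_mul] at this
    nlinarith
  refine le_of_forall_gt_imp_ge_of_dense fun c hc => ?_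
  have hαβ : 0 < α + β := add_pos hα hβ
  have := key (c / (α + β)) ((one_lt_div hαβ).2 hc)
  rwa [mul_div_cancel₀ _ hαβ.ne'] at this

/-- Gauge-preserving bijections are additive on the open cone. -/
lemma GaugePreserving.map_add (hV : IsOrderUnitSpace V P v) (hW : IsOrderUnitSpace W Q w)
    {A : V → W} (hA : GaugePreserving P v Q w A) {a b : V} (ha : a ∈ openCone P v)
    (hb : b ∈ openCone P v) : A (a + b) = A a + A b := by
  have hAa := hA.1.mapsTo ha
  have hAb := hA.1.mapsTo hb
  have hsum := hW.add_mem_openCone hAa (hW.mem_of_mem_openCone hAb)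
  have hinv := (Set.BijOn.invOn_invFunOn hA.1).1
  refine hW.eq_of_sub_mem (hA.add_le hV hW ha hb) ?_
  have h := (hA.invFunOn hV).add_le hW hV hAa hAb
  rw [hinv ha, hinv hb] at h
  have h' := (hA.2.2 _ (Function.invFunOn_mem (hA.1.surjOn hsum)) _
    (hV.add_mem_openCone ha (hV.mem_of_mem_openCone hb))).1 h
  rwa [Function.invFunOn_eq (hA.1.surjOn hsum)] at h'

/-- An additive and positively homogeneous function on the open cone extends to a linear map. -/
lemma IsOrderUnitSpace.exists_linearMap_eqOn (hV : IsOrderUnitSpace V P v) {A : V → W}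
    (hadd : ∀ a ∈ openCone P v, ∀ b ∈ openCone P v, A (a + b) = A a + A b)
    (hsmul : ∀ a ∈ openCone P v, ∀ r : ℝ, 0 < r → A (r • a) = r • A a) :
    ∃ L : V →ₗ[ℝ] W, ∀ a ∈ openCone P v, L a = A a := by
  choose p hp q hq hpq using hV.exists_eq_sub
  have hmem : ∀ {a b : V}, a ∈ openCone P v → b ∈ openCone P v → a + b ∈ openCone P v :=
    fun ha hb => hV.add_mem_openCone ha (hV.mem_of_mem_openCone hb)
  have key : ∀ z, ∀ a ∈ openCone P v, ∀ b ∈ openCone P v, z = a - b →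
      A (p z) - A (q z) = A a - A b := by
    intro z a ha b hb hz
    have h : p z + b = a + q z := by
      rw [hpq z, sub_eq_sub_iff_add_eq_add] at hz
      exact hz
    rw [sub_eq_sub_iff_add_eq_add, ← hadd _ (hp z) _ hb, ← hadd _ ha _ (hq z), h]
  refine ⟨⟨⟨fun z => A (p z) - A (q z), fun y z => ?_⟩, fun r z => ?_⟩, fun a ha => ?_⟩
  · rw [key (y + z) _ (hmem (hp y) (hp z)) _ (hmem (hq y) (hq z)) (by
      conv_lhs => rw [hpq y, hpq z]
      abel), hadd _ (hp y) _ (hp z), hadd _ (hq y) _ (hq z)]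
    abel
  · change A (p (r • z)) - A (q (r • z)) = r • (A (p z) - A (q z))
    rcases lt_trichotomy r 0 with hr | rfl | hr
    · have hr' : 0 < -r := by linarith
      rw [key (r • z) _ (hV.smul_mem_openCone (hq z) hr') _ (hV.smul_mem_openCone (hp z) hr') (by
        conv_lhs => rw [hpq z]
        module), hsmul _ (hp z) _ hr', hsmul _ (hq z) _ hr']
      module
    · rw [key ((0 : ℝ) • z) v hV.unit_mem_openCone v hV.unit_mem_openCone (by simp)]
      simp
    · rw [key (r • z) _ (hV.smul_mem_openCone (hp z) hr) _ (hV.smul_mem_openCone (hq z) hr) (by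
        conv_lhs => rw [hpq z]
        module), hsmul _ (hp z) _ hr, hsmul _ (hq z) _ hr, smul_sub]
  · change A (p a) - A (q a) = A a
    rw [key a (a + v) (hmem ha hV.unit_mem_openCone) v hV.unit_mem_openCone (by abel),
      hadd _ ha _ hV.unit_mem_openCone]
    abel

/-- A gauge-preserving bijection between open cones is the restriction of a linear
isomorphism of order unit spaces. -/
lemma GaugePreserving.exists_linearMap (hV : IsOrderUnitSpace V P v)
    (hW : IsOrderUnitSpace W Q w) {A : V → W} (hA : GaugePreserving P v Q w A) :
    ∃ L : V →ₗ[ℝ] W, (∀ a ∈ openCone P v, L a = A a) ∧ Function.Bijective L ∧ L '' P = Q := by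
  obtain ⟨L, hL⟩ := hV.exists_linearMap_eqOn (fun a ha b hb => hA.map_add hV hW ha hb) hA.2.1
  have hinj : Function.Injective L := by
    refine (injective_iff_map_eq_zero L).2 fun z hz => ?_
    obtain ⟨a, ha, b, hb, rfl⟩ := hV.exists_eq_sub z
    rw [_root_.map_sub, sub_eq_zero, hL a ha, hL b hb] at hz
    rw [hA.1.injOn ha hb hz, sub_self]
  have hsurj : ∀ b ∈ openCone Q w, ∃ a ∈ openCone P v, L a = b := fun b hb => by
    obtain ⟨a, ha, rfl⟩ := hA.1.surjOn hb
    exact ⟨a, ha, hL a ha⟩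
  have hLv : L v ∈ openCone Q w := by
    rw [hL v hV.unit_mem_openCone]
    exact hA.1.mapsTo hV.unit_mem_openCone
  have hbij : Function.Bijective L := by
    refine ⟨hinj, fun y => ?_⟩
    obtain ⟨a, ha, b, hb, rfl⟩ := hW.exists_eq_sub y
    obtain ⟨c, -, rfl⟩ := hsurj a ha
    obtain ⟨d, -, rfl⟩ := hsurj b hb
    exact ⟨c - d, _root_.map_sub L c d⟩
  refine ⟨L, hL, hbij, Set.Subset.antisymm ?_ fun y hy => ?_⟩
  · rintro _ ⟨z, hz, rfl⟩
    refine hW.mem_of_forall_add_smul_mem (hW.mem_of_mem_openCone hLv) fun ε hε _ => ?_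
    have hz' : z + ε • v ∈ openCone P v := by
      rw [add_comm]
      exact hV.add_mem_openCone (hV.smul_mem_openCone hV.unit_mem_openCone hε) hz
    rw [← _root_.map_smul, ← _root_.map_add, hL _ hz']
    exact hW.mem_of_mem_openCone (hA.1.mapsTo hz')
  · obtain ⟨z, rfl⟩ := hbij.2 y
    refine ⟨z, hV.mem_of_forall_add_smul_mem hV.unit_mem fun ε hε _ => ?_, rfl⟩
    have hz' : L z + ε • L v ∈ openCone Q w := by
      rw [add_comm]
      exact hW.add_mem_openCone (hW.smul_mem_openCone hLv hε) hy
    obtain ⟨c, hc, hcz⟩ := hsurj _ hz'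
    rw [← _root_.map_smul, ← _root_.map_add] at hcz
    rw [← hinj hcz]
    exact hV.mem_of_mem_openCone hc

end OrderMaps

namespace GaugeReversing

variable {V : Type*} [NormedAddCommGroup V] [NormedSpace ℝ V] {P : Set V} {v : V}
variable {W : Type*} [NormedAddCommGroup W] [NormedSpace ℝ W] {Q : Set W} {w : W}
variable {Φ : V → W}

lemma sub_inv_smul_mem (hΦ : GaugeReversing P v Q w Φ) (hV : IsOrderUnitSpace V P v) {a b : V}
    (ha : a ∈ openCone P v) (hb : b ∈ openCone P v) {r : ℝ} (hr : 0 < r) (h : r • a - b ∈ P) :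
    Φ b - r⁻¹ • Φ a ∈ Q := by
  rw [← hΦ.2.1 a ha r hr]
  exact (hΦ.2.2 b hb _ (hV.smul_mem_openCone ha hr)).1 h

lemma inv_smul_sub_mem (hΦ : GaugeReversing P v Q w Φ) (hV : IsOrderUnitSpace V P v) {a b : V}
    (ha : a ∈ openCone P v) (hb : b ∈ openCone P v) {r : ℝ} (hr : 0 < r) (h : b - r • a ∈ P) :
    r⁻¹ • Φ a - Φ b ∈ Q := by
  rw [← hΦ.2.1 a ha r hr]
  exact (hΦ.2.2 _ (hV.smul_mem_openCone ha hr) b hb).1 h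

/-- A gauge-reversing bijection `Φ` and a point `x` determine a self-map `T` of the open cone
for which `x + y` and `x + T y` are complementary: their images under `Φ` add up to `Φ x`. -/
lemma exists_complement (hΦ : GaugeReversing P v Q w Φ) (hV : IsOrderUnitSpace V P v)
    (hW : IsOrderUnitSpace W Q w) {x : V} (hx : x ∈ openCone P v) :
    ∃ T : V → V, ∀ y ∈ openCone P v, T y ∈ openCone P v ∧ Φ (x + T y) = Φ x - Φ (x + y) := by
  suffices ∀ y, ∃ z, y ∈ openCone P v → z ∈ openCone P v ∧ Φ (x + z) = Φ x - Φ (x + y) by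
    choose T hT using this
    exact ⟨T, hT⟩
  intro y
  by_cases hy : y ∈ openCone P v
  swap
  · exact ⟨y, fun h => absurd h hy⟩
  have hu := hΦ.1.mapsTo hx
  have hxy := hV.add_mem_openCone hx (hV.mem_of_mem_openCone hy)
  obtain ⟨r, hr, hrx⟩ := hV.exists_smul_sub_mem hy x
  obtain ⟨n, hn, hny⟩ := hV.exists_smul_sub_mem hx y
  have hlow : (1 + r⁻¹)⁻¹ • Φ x - Φ (x + y) ∈ Q := by
    refine hΦ.inv_smul_sub_mem hV hx hxy (by positivity) ?_
    convert hV.smul_mem r⁻¹ (by positivity) _ hrx using 1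
    rw [smul_sub, inv_smul_smul₀ hr.ne']
    module
  have hupp : Φ (x + y) - (1 + n)⁻¹ • Φ x ∈ Q := by
    refine hΦ.sub_inv_smul_mem hV hx hxy (by positivity) ?_
    convert hny using 1
    module
  have hD : Φ x - Φ (x + y) ∈ openCone Q w := by
    have hpos : 0 < 1 - (1 + r⁻¹)⁻¹ :=
      sub_pos.2 (inv_lt_one_of_one_lt₀ (by linarith [inv_pos.2 hr]))
    refine hW.mem_openCone_of_sub_mem (hW.smul_mem_openCone hu hpos) ?_
    convert hlow using 1
    module
  obtain ⟨z, hz, hzy⟩ := hΦ.1.surjOn hD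
  have hzx : z - (1 + n⁻¹) • x ∈ P := by
    refine (hΦ.2.2 _ (hV.smul_mem_openCone hx (by positivity)) z hz).2 ?_
    rw [hΦ.2.1 x hx _ (by positivity), hzy]
    convert hupp using 1
    rw [show (1 + n⁻¹)⁻¹ = 1 - (1 + n)⁻¹ by field_simp; ring]
    module
  refine ⟨z - x, fun _ => ⟨?_, by rw [add_sub_cancel, hzy]⟩⟩
  refine hV.mem_openCone_of_sub_mem (hV.smul_mem_openCone hx (inv_pos.2 hn)) ?_
  convert hzx using 1
  module

section Complement

variable {x : V} {T : V → V}

lemma complement_anti (hΦ : GaugeReversing P v Q w Φ) (hV : IsOrderUnitSpace V P v)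
    (hx : x ∈ openCone P v)
    (hT : ∀ y ∈ openCone P v, T y ∈ openCone P v ∧ Φ (x + T y) = Φ x - Φ (x + y))
    {a b : V} (ha : a ∈ openCone P v) (hb : b ∈ openCone P v) :
    b - a ∈ P ↔ T a - T b ∈ P := by
  have hadd : ∀ {c}, c ∈ openCone P v → x + c ∈ openCone P v := fun hc =>
    hV.add_mem_openCone hx (hV.mem_of_mem_openCone hc)
  have h₁ := hΦ.2.2 _ (hadd ha) _ (hadd hb)
  have h₂ := hΦ.2.2 _ (hadd (hT b hb).1) _ (hadd (hT a ha).1)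
  rw [(hT a ha).2, (hT b hb).2, sub_sub_sub_cancel_left, add_sub_add_left_eq_sub] at h₂
  rw [add_sub_add_left_eq_sub] at h₁
  exact h₁.trans h₂.symm

lemma complement_eq (hΦ : GaugeReversing P v Q w Φ) (hV : IsOrderUnitSpace V P v)
    (hx : x ∈ openCone P v)
    (hT : ∀ y ∈ openCone P v, T y ∈ openCone P v ∧ Φ (x + T y) = Φ x - Φ (x + y))
    {a b : V} (ha : a ∈ openCone P v) (hb : b ∈ openCone P v) (h : Φ (x + a) + Φ (x + b) = Φ x) :
    T a = b := by
  have hadd : ∀ {c}, c ∈ openCone P v → x + c ∈ openCone P v := fun hc =>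
    hV.add_mem_openCone hx (hV.mem_of_mem_openCone hc)
  refine add_left_cancel (hΦ.1.injOn (hadd (hT a ha).1) (hadd hb) ?_)
  rw [(hT a ha).2, ← h, add_sub_cancel_left]

lemma complement_complement (hΦ : GaugeReversing P v Q w Φ) (hV : IsOrderUnitSpace V P v)
    (hx : x ∈ openCone P v)
    (hT : ∀ y ∈ openCone P v, T y ∈ openCone P v ∧ Φ (x + T y) = Φ x - Φ (x + y))
    {a : V} (ha : a ∈ openCone P v) : T (T a) = a :=
  hΦ.complement_eq hV hx hT (hT a ha).1 ha (by rw [(hT a ha).2, sub_add_cancel])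

lemma complement_smul_self (hΦ : GaugeReversing P v Q w Φ) (hV : IsOrderUnitSpace V P v)
    (hx : x ∈ openCone P v)
    (hT : ∀ y ∈ openCone P v, T y ∈ openCone P v ∧ Φ (x + T y) = Φ x - Φ (x + y))
    {r : ℝ} (hr : 0 < r) : T (r • x) = r⁻¹ • x := by
  refine hΦ.complement_eq hV hx hT (hV.smul_mem_openCone hx hr)
    (hV.smul_mem_openCone hx (inv_pos.2 hr)) ?_
  have key : ∀ s : ℝ, 0 < s → Φ (x + s • x) = (1 + s)⁻¹ • Φ x := fun s hs => by
    rw [← hΦ.2.1 x hx (1 + s) (by positivity), add_smul, one_smul]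
  rw [key r hr, key r⁻¹ (inv_pos.2 hr), ← add_smul]
  convert one_smul ℝ (Φ x) using 2
  field_simp
  ring

lemma complement_smul (hΦ : GaugeReversing P v Q w Φ) (hV : IsOrderUnitSpace V P v)
    (hx : x ∈ openCone P v)
    (hT : ∀ y ∈ openCone P v, T y ∈ openCone P v ∧ Φ (x + T y) = Φ x - Φ (x + y))
    {a : V} (ha : a ∈ openCone P v) {r : ℝ} (hr : 0 < r) : T (r • a) = r⁻¹ • T a := by
  have key : ∀ s : ℝ, 0 < s → s ≤ 1 → ∀ b ∈ openCone P v, T (s • b) = s⁻¹ • T b := by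
    intro s hs hs₁ b hb
    have hmem : ∀ c ∈ openCone P v, s • T c ∈ openCone P v := fun c hc =>
      hV.smul_mem_openCone (hT c hc).1 hs
    have hS := hV.eq_smul_of_ray (S := fun c => T (s • T c)) (κ := s⁻¹) ?_ ?_ hx (inv_pos.2 hs)
      ?_ (hT b hb).1
    · rwa [hΦ.complement_complement hV hx hT hb] at hS
    · intro c hc d hd
      rw [hΦ.complement_anti hV hx hT hc hd,
        ← hΦ.complement_anti hV hx hT (hmem d hd) (hmem c hc), ← smul_sub]
      exact ⟨hV.smul_mem s hs.le _, hV.mem_of_smul_mem hs⟩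
    · intro c hc
      have h := hΦ.complement_anti hV hx hT (hmem c hc) (hT c hc).1
      rw [hΦ.complement_complement hV hx hT hc] at h
      refine h.1 ?_
      convert hV.smul_mem (1 - s) (by linarith) _ (hV.mem_of_mem_openCone (hT c hc).1) using 1
      module
    · intro t ht
      simp only [hΦ.complement_smul_self hV hx hT ht, smul_smul]
      rw [hΦ.complement_smul_self hV hx hT (by positivity), mul_inv, inv_inv]
  rcases le_total r 1 with h | h
  · exact key r hr h a ha
  · have := key r⁻¹ (inv_pos.2 hr) (inv_le_one_of_one_le₀ h) (r • a) (hV.smul_mem_openCone ha hr)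
    rw [inv_smul_smul₀ hr.ne', inv_inv] at this
    rw [this, inv_smul_smul₀ hr.ne']

lemma gaugePreserving_comp_complement (hΦ : GaugeReversing P v Q w Φ)
    (hV : IsOrderUnitSpace V P v) (hx : x ∈ openCone P v)
    (hT : ∀ y ∈ openCone P v, T y ∈ openCone P v ∧ Φ (x + T y) = Φ x - Φ (x + y)) :
    GaugePreserving P v Q w (Φ ∘ T) := by
  have hTbij : Set.BijOn T (openCone P v) (openCone P v) :=
    Set.InvOn.bijOn ⟨fun a ha => hΦ.complement_complement hV hx hT ha,
      fun a ha => hΦ.complement_complement hV hx hT ha⟩ (fun a ha => (hT a ha).1)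
      (fun a ha => (hT a ha).1)
  refine ⟨hΦ.1.comp hTbij, fun a ha r hr => ?_, fun a ha b hb => ?_⟩
  · rw [Function.comp_apply, hΦ.complement_smul hV hx hT ha hr,
      hΦ.2.1 _ (hT a ha).1 _ (inv_pos.2 hr), inv_inv, Function.comp_apply]
  · rw [hΦ.complement_anti hV hx hT ha hb, hΦ.2.2 _ (hT b hb).1 _ (hT a ha).1]
    rfl

lemma comp_complement_bounds (hΦ : GaugeReversing P v Q w Φ) (hV : IsOrderUnitSpace V P v)
    (hW : IsOrderUnitSpace W Q w) (hx : x ∈ openCone P v)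
    (hT : ∀ y ∈ openCone P v, T y ∈ openCone P v ∧ Φ (x + T y) = Φ x - Φ (x + y))
    {y : V} (hy : y ∈ openCone P v) {n : ℝ} (hn : 0 < n) (hny : n • x - y ∈ P) :
    Φ (x + y) - Φ x + Φ (T y) ∈ Q ∧ n ^ 2 • Φ x - (Φ (x + y) - Φ x + Φ (T y)) ∈ Q := by
  have hTy := (hT y hy).1
  have hxT := hV.add_mem_openCone hx (hV.mem_of_mem_openCone hTy)
  have hnx := hV.smul_mem_openCone hx hn
  have hlow : T y - n⁻¹ • x ∈ P := by
    rw [← hΦ.complement_smul_self hV hx hT hn]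
    exact (hΦ.complement_anti hV hx hT hy hnx).1 hny
  have hE : Φ (x + y) - Φ x + Φ (T y) = Φ (T y) - Φ (x + T y) := by
    rw [(hT y hy).2]
    abel
  rw [hE]
  refine ⟨(hΦ.2.2 _ hTy _ hxT).1 (by simpa using hV.mem_of_mem_openCone hx), ?_⟩
  have h₁ : Φ (x + T y) - (1 + n)⁻¹ • Φ (T y) ∈ Q := by
    refine hΦ.sub_inv_smul_mem hV hTy hxT (by positivity) ?_
    convert hV.smul_mem n hn.le _ hlow using 1
    rw [smul_sub, smul_inv_smul₀ hn.ne']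
    module
  have h₂ : n • Φ x - Φ (T y) ∈ Q := by
    simpa using hΦ.inv_smul_sub_mem hV hx hTy (inv_pos.2 hn) hlow
  have h₃ : 0 ≤ n - (1 - (1 + n)⁻¹) := by
    have : n - (1 - (1 + n)⁻¹) = n ^ 2 / (1 + n) := by field_simp; ring
    rw [this]
    positivity
  have h₄ : 0 ≤ 1 - (1 + n)⁻¹ := sub_nonneg.2 (inv_le_one_of_one_le₀ (by linarith))
  have hu := hW.mem_of_mem_openCone (hΦ.1.mapsTo hx)
  convert hW.add_mem _ (hW.add_mem _ h₁ _ (hW.smul_mem _ h₄ _ h₂)) _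
    (hW.smul_mem (n * (n - (1 - (1 + n)⁻¹))) (by positivity) _ hu) using 1
  module

end Complement

/-- The derivative estimate extends from the open cone to the whole cone. -/
lemma ounorm_le_sq (hΦ : GaugeReversing P v Q w Φ) (hV : IsOrderUnitSpace V P v)
    (hW : IsOrderUnitSpace W Q w) {x : V} (hx : x ∈ openCone P v) {A : V →ₗ[ℝ] W}
    (hAx : A x = Φ x)
    (hA : ∀ y ∈ openCone P v, ∀ n : ℝ, 0 < n → n • x - y ∈ P →
      Φ (x + y) - Φ x + A y ∈ Q ∧ n ^ 2 • Φ x - (Φ (x + y) - Φ x + A y) ∈ Q)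
    {y : V} (hy : y ∈ P) :
    ounorm Q (Φ x) (Φ (x + y) - Φ x + A y) ≤ ounorm P x y ^ 2 := by
  have hxP := hV.mem_of_mem_openCone hx
  have hu := hW.mem_of_mem_openCone (hΦ.1.mapsTo hx)
  have hn := IsOrderUnitSpace.ounorm_nonneg P x y
  have hny := (hV.mem_of_ounorm_le hx le_rfl : y + ounorm P x y • x ∈ P ∧ _).2
  set n := ounorm P x y
  have hxy := hV.add_mem_openCone hx hy
  have hux : Φ x - Φ (x + y) ∈ Q := (hΦ.2.2 _ hx _ hxy).1 (by simpa using hy)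
  have key : ∀ ε : ℝ, 0 < ε → ε ≤ 1 → (Φ (x + y) - Φ x + A y) + ε • Φ x ∈ Q ∧
      n ^ 2 • Φ x - (Φ (x + y) - Φ x + A y) + ε • ((2 * n + 2) • Φ x) ∈ Q := by
    intro ε hε hε₁
    have hy' : y + ε • x ∈ openCone P v := by
      rw [add_comm]
      exact hV.add_mem_openCone (hV.smul_mem_openCone hx hε) hy
    have hxy' := hV.add_mem_openCone hx (hV.mem_of_mem_openCone hy')
    obtain ⟨h₁, h₂⟩ := hA _ hy' (n + ε) (by positivity) (by
      convert hny using 1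
      module)
    rw [_root_.map_add, map_smul, hAx] at h₁ h₂
    have h₃ : Φ (x + y) - Φ (x + (y + ε • x)) ∈ Q :=
      (hΦ.2.2 _ hxy _ hxy').1 (by
        convert hV.smul_mem ε hε.le _ hxP using 1
        module)
    have h₄ : Φ (x + (y + ε • x)) - (1 + ε)⁻¹ • Φ (x + y) ∈ Q := by
      refine hΦ.sub_inv_smul_mem hV hxy hxy' (by positivity) ?_
      convert hV.smul_mem ε hε.le _ hy using 1
      module
    have h₅ : 0 ≤ 1 - (1 + ε)⁻¹ := sub_nonneg.2 (inv_le_one_of_one_le₀ (by linarith))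
    have h₆ := hW.add_mem _ h₄ _ (hW.smul_mem _ h₅ _ hux)
    have h₇ : 0 ≤ (1 + ε)⁻¹ - 1 + 3 * ε - ε ^ 2 := by
      have : 1 - ε ≤ (1 + ε)⁻¹ := by
        rw [← one_div, le_div_iff₀ (by linarith)]
        nlinarith
      nlinarith
    constructor
    · convert hW.add_mem _ h₁ _ h₃ using 1
      module
    · convert hW.add_mem _ (hW.add_mem _ h₂ _ h₆) _ (hW.smul_mem _ h₇ _ hu) using 1
      module
  have h₁ := hW.mem_of_forall_add_smul_mem hu fun ε hε hε₁ => (key ε hε hε₁).1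
  have h₂ := hW.mem_of_forall_add_smul_mem (hW.smul_mem (2 * n + 2) (by positivity) _ hu)
    fun ε hε hε₁ => (key ε hε hε₁).2
  exact IsOrderUnitSpace.ounorm_le (by positivity)
    (hW.add_mem _ h₁ _ (hW.smul_mem _ (by positivity) _ hu)) h₂

/-- A linear map satisfying the derivative estimate lies below any other such map. -/
lemma sub_mem_of_ounorm_le_sq (hΦ : GaugeReversing P v Q w Φ) (hV : IsOrderUnitSpace V P v)
    (hW : IsOrderUnitSpace W Q w) {x : V} (hx : x ∈ openCone P v) {A B : V →ₗ[ℝ] W}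
    (hA : ∀ y ∈ P, ounorm Q (Φ x) (Φ (x + y) - Φ x + A y) ≤ ounorm P x y ^ 2)
    (hB : ∀ y ∈ P, ounorm Q (Φ x) (Φ (x + y) - Φ x + B y) ≤ ounorm P x y ^ 2)
    {y : V} (hy : y ∈ P) : B y - A y ∈ Q := by
  have hu := hΦ.1.mapsTo hx
  have hn := IsOrderUnitSpace.ounorm_nonneg P x y
  obtain ⟨hn₁, hn₂⟩ := hV.mem_of_ounorm_le hx (le_refl (ounorm P x y))
  set n := ounorm P x y
  refine hW.mem_of_forall_add_smul_mem
    (hW.smul_mem (2 * n ^ 2) (by positivity) _ (hW.mem_of_mem_openCone hu)) fun t ht _ => ?_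
  have hty := hV.smul_mem t ht.le _ hy
  have hle : ounorm P x (t • y) ^ 2 ≤ (t * n) ^ 2 := by
    refine pow_le_pow_left₀ (IsOrderUnitSpace.ounorm_nonneg P x _) ?_ 2
    refine IsOrderUnitSpace.ounorm_le (by positivity) ?_ ?_
    · convert hV.smul_mem t ht.le _ hn₁ using 1
      module
    · convert hV.smul_mem t ht.le _ hn₂ using 1
      module
  have h₁ := (hW.mem_of_ounorm_le hu ((hA _ hty).trans hle)).2
  have h₂ := (hW.mem_of_ounorm_le hu ((hB _ hty).trans hle)).1
  rw [map_smul] at h₁ h₂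
  refine hW.mem_of_smul_mem ht ?_
  convert hW.add_mem _ h₁ _ h₂ using 1
  module

end GaugeReversing

/-- Let `Φ` be a gauge-reversing bijection between the open cones of
two complete order unit spaces. Then for each `x` in the open cone there exists a
unique linear bijection `A : V → W` with `A(P) = Q` and `A x = Φ x` (an isomorphism of
order unit spaces `(V, P, x) → (W, Q, Φ x)`) such that
`‖Φ(x+y) − Φ(x) + A y‖_{Φ x} ≤ ‖y‖_x²` for all `y ∈ P`. -/
theorem exists_unique_derivative_isomorphism
    {V : Type*} [NormedAddCommGroup V] [NormedSpace ℝ V] [CompleteSpace V]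
    {W : Type*} [NormedAddCommGroup W] [NormedSpace ℝ W] [CompleteSpace W]
    (P : Set V) (v : V) (Q : Set W) (w : W)
    (hV : IsOrderUnitSpace V P v) (hW : IsOrderUnitSpace W Q w)
    (Φ : V → W) (hΦ : GaugeReversing P v Q w Φ) :
    ∀ x ∈ openCone P v, ∃! A : V →ₗ[ℝ] W,
      Function.Bijective A ∧ (⇑A) '' P = Q ∧ A x = Φ x ∧
      ∀ y ∈ P, ounorm Q (Φ x) (Φ (x + y) - Φ x + A y) ≤ (ounorm P x y) ^ 2 := by
  intro x hx
  obtain ⟨T, hT⟩ := hΦ.exists_complement hV hW hx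
  obtain ⟨A, hAT, hbij, himg⟩ :=
    (hΦ.gaugePreserving_comp_complement hV hx hT).exists_linearMap hV hW
  have hAx : A x = Φ x := by
    have := hΦ.complement_smul_self hV hx hT one_pos
    rw [inv_one, one_smul] at this
    rw [hAT x hx, Function.comp_apply, this]
  have hA : ∀ y ∈ P, ounorm Q (Φ x) (Φ (x + y) - Φ x + A y) ≤ ounorm P x y ^ 2 := by
    refine fun y hy => hΦ.ounorm_le_sq hV hW hx hAx (fun z hz n hn hnz => ?_) hy
    rw [hAT z hz]
    exact hΦ.comp_complement_bounds hV hW hx hT hz hn hnz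
  refine ⟨A, ⟨hbij, himg, hAx, hA⟩, fun B ⟨_, _, _, hB⟩ => ?_⟩
  have heq : ∀ y ∈ openCone P v, B y = A y := fun y hy =>
    have hyP := hV.mem_of_mem_openCone hy
    hW.eq_of_sub_mem (hΦ.sub_mem_of_ounorm_le_sq hV hW hx hB hA hyP)
      (hΦ.sub_mem_of_ounorm_le_sq hV hW hx hA hB hyP)
  ext a
  obtain ⟨p, hp, q, hq, rfl⟩ := hV.exists_eq_sub a
  rw [map_sub, map_sub, heq p hp, heq q hq]
end

section
/- Let (V, V₊, v) and (W, W₊, w) be complete order unit spaces with open cones C := V₊° and D := W₊°, and let Φ: C → D be a gauge-reversing bijection. Then Φ satisfies Hua's identity: for all x, y ∈ C, the element Φ(x) + Φ(y) lies in D, and Φ(x) − Φ(x+y) = −DΦ(x)(Φ⁻¹(Φ(x) + Φ(y))), where DΦ(x): V → W denotes the Fréchet derivative of Φ at x (with respect to the order unit norms ‖·‖_v and ‖·‖_w). -/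
open scoped Topology

namespace OrderUnit

open Set

section States

variable {V : Type*} [NormedAddCommGroup V] [NormedSpace ℝ V] [PartialOrder V]
  [IsOrderedAddMonoid V] [PosSMulMono ℝ V] {v : V}

theorem le_of_forall_smul_le (hV : IsOrderUnitSpace V (Ici 0) v) {x : V}
    (h : ∀ r : ℝ, 0 < r → x ≤ r • v) : x ≤ 0 := by
  have := hV.archimedean x v fun r hr => by
    rcases hr.eq_or_lt with rfl | hr
    · simpa using hV.unit_mem
    · have h1 := smul_le_smul_of_nonneg_left (h r⁻¹ (by positivity)) hr.le
      rw [smul_smul, mul_inv_cancel₀ hr.ne', one_smul] at h1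
      simpa using h1
  simpa using this

omit [PosSMulMono ℝ V] in
theorem norm_le_of_abs_le (hV : IsOrderUnitSpace V (Ici 0) v) {x : V} {r : ℝ} (hr : 0 ≤ r)
    (h₁ : -(r • v) ≤ x) (h₂ : x ≤ r • v) : ‖x‖ ≤ r := by
  rw [hV.norm_eq]
  refine csInf_le ⟨0, fun s hs => hs.1⟩ ⟨hr, ?_, ?_⟩
  · simpa [neg_le_iff_add_nonneg] using h₁
  · simpa using h₂

theorem le_norm_smul (hV : IsOrderUnitSpace V (Ici 0) v) (x : V) : x ≤ ‖x‖ • v := by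
  have hv : (0 : V) ≤ v := hV.unit_mem
  have hne : {r : ℝ | 0 ≤ r ∧ x + r • v ∈ Ici (0 : V) ∧ r • v - x ∈ Ici (0 : V)}.Nonempty := by
    obtain ⟨r, hr, h₁⟩ := hV.unit_order x
    obtain ⟨s, hs, h₂⟩ := hV.unit_order (-x)
    refine ⟨r + s, by positivity, ?_, ?_⟩
    · have h := add_nonneg (mem_Ici.1 h₂) (smul_nonneg hr.le hv)
      rw [mem_Ici]; convert h using 1; module
    · have h := add_nonneg (mem_Ici.1 h₁) (smul_nonneg hs.le hv)
      rw [mem_Ici]; convert h using 1; module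
  rw [← sub_nonpos]
  refine le_of_forall_smul_le hV fun r hr => ?_
  obtain ⟨s, ⟨-, -, hs⟩, hlt⟩ := exists_lt_of_csInf_lt hne
    (show sInf _ < ‖x‖ + r by rw [← hV.norm_eq]; linarith)
  rw [mem_Ici, sub_nonneg] at hs
  rw [sub_le_iff_le_add, ← add_smul, add_comm]
  refine hs.trans ?_
  have := smul_nonneg (sub_nonneg.2 hlt.le) hv
  rwa [sub_smul, sub_nonneg] at this

theorem neg_norm_smul_le (hV : IsOrderUnitSpace V (Ici 0) v) (x : V) : -(‖x‖ • v) ≤ x := by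
  simpa using neg_le_neg (le_norm_smul hV (-x))

theorem isClosed_Ici_zero (hV : IsOrderUnitSpace V (Ici 0) v) : IsClosed (Ici (0 : V)) := by
  refine isClosed_of_closure_subset fun x hx => ?_
  rw [mem_Ici, ← neg_nonpos]
  refine le_of_forall_smul_le hV fun r hr => ?_
  obtain ⟨y, hy, hxy⟩ := Metric.mem_closure_iff.1 hx r hr
  rw [dist_eq_norm] at hxy
  have h₁ := neg_norm_smul_le hV (x - y)
  have h₂ := smul_nonneg (sub_nonneg.2 hxy.le) (mem_Ici.1 hV.unit_mem)
  rw [sub_smul, sub_nonneg] at h₂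
  rw [neg_le]
  refine (neg_le_neg h₂).trans (h₁.trans ?_)
  simpa using hy

/-- A state whose strict sublevel sets are upward directed. -/
structure IsDirectedState (v : V) (ρ : V →L[ℝ] ℝ) : Prop where
  nonneg : ∀ x, 0 ≤ x → 0 ≤ ρ x
  unit : ρ v = 1
  directed : ∀ (a b : V) (r : ℝ), ρ a < r → ρ b < r → ∃ c, a ≤ c ∧ b ≤ c ∧ ρ c < r

omit [IsOrderedAddMonoid V] [PosSMulMono ℝ V] in
theorem convex_stateSpace : Convex ℝ (stateSpace (Ici 0) v) := by
  rintro ρ ⟨h₁, h₂⟩ σ ⟨h₃, h₄⟩ s t hs ht hst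
  refine ⟨fun x hx => ?_, ?_⟩
  · change 0 ≤ s * ρ x + t * σ x
    have := h₁ x hx
    have := h₃ x hx
    positivity
  · change s * ρ v + t * σ v = 1
    rw [h₂, h₄]; linarith

theorem isCompact_stateSpace (hV : IsOrderUnitSpace V (Ici 0) v) :
    IsCompact (stateSpace (Ici 0) v) := by
  refine (WeakDual.isCompact_closedBall (𝕜 := ℝ) (E := V) 0 1).of_isClosed_subset ?_ ?_
  · have : stateSpace (Ici 0) v =
        (⋂ x ∈ Ici (0 : V), {ρ : WeakDual ℝ V | 0 ≤ ρ x}) ∩ {ρ | ρ v = 1} := by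
      ext ρ; simp [stateSpace]
    rw [this]
    exact (isClosed_biInter fun x _ =>
      isClosed_le continuous_const (WeakDual.eval_continuous x)).inter
        (isClosed_eq (WeakDual.eval_continuous v) continuous_const)
  · rintro ρ ⟨h₁, h₂⟩
    rw [mem_preimage, mem_closedBall_zero_iff]
    refine ContinuousLinearMap.opNorm_le_bound _ zero_le_one fun x => ?_
    have a := h₁ _ (sub_nonneg.2 (le_norm_smul hV x))
    have b := h₁ _ (sub_nonneg.2 (neg_norm_smul_le hV x))
    simp only [map_sub, map_neg, map_smul, h₂, smul_eq_mul, mul_one] at a b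
    change ‖ρ x‖ ≤ _
    rw [Real.norm_eq_abs, abs_le]
    constructor <;> linarith

theorem nonneg_of_forall_extremePoints (hV : IsOrderUnitSpace V (Ici 0) v) {x : V}
    (h : ∀ ρ ∈ (stateSpace (Ici 0) v).extremePoints ℝ, 0 ≤ ρ x) : 0 ≤ x := by
  by_contra hx
  obtain ⟨f, u, hfx, hf⟩ := geometric_hahn_banach_point_closed (convex_Ici (0 : V))
    (isClosed_Ici_zero hV) (show x ∉ Ici (0 : V) from hx)
  have hu : u < 0 := by simpa using hf 0 self_mem_Ici
  have hpos : ∀ y : V, 0 ≤ y → 0 ≤ f y := by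
    intro y hy
    by_contra! hy'
    have := hf ((u / f y) • y) (smul_nonneg (div_nonneg_of_nonpos hu.le hy'.le) hy)
    rw [map_smul, smul_eq_mul, div_mul_cancel₀ _ hy'.ne] at this
    exact lt_irrefl _ this
  have hv : 0 < f v := by
    have h₁ := hpos _ (sub_nonneg.2 (neg_norm_smul_le hV x))
    simp only [map_sub, map_neg, map_smul, smul_eq_mul] at h₁
    by_contra! hv
    nlinarith [norm_nonneg x]
  let σ : WeakDual ℝ V := ((f v)⁻¹ • f : V →L[ℝ] ℝ)
  have hσa : ∀ y, σ y = (f v)⁻¹ * f y := fun y => rfl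
  have hσ : σ ∈ stateSpace (Ici 0) v := by
    refine ⟨fun y hy => ?_, ?_⟩
    · rw [hσa]; have := hpos y hy; positivity
    · rw [hσa, inv_mul_cancel₀ hv.ne']
  have : LocallyConvexSpace ℝ (WeakDual ℝ V) :=
    inferInstanceAs (LocallyConvexSpace ℝ (WeakBilin (topDualPairing ℝ V)))
  rw [← closure_convexHull_extremePoints (isCompact_stateSpace hV) convex_stateSpace] at hσ
  have hcl : IsClosed {ρ : WeakDual ℝ V | 0 ≤ ρ x} :=
    isClosed_le continuous_const (WeakDual.eval_continuous x)
  have hco : Convex ℝ {ρ : WeakDual ℝ V | 0 ≤ ρ x} := by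
    intro ρ hρ τ hτ s t hs ht _
    change 0 ≤ s * ρ x + t * τ x
    have h1 : 0 ≤ ρ x := hρ
    have h2 : 0 ≤ τ x := hτ
    positivity
  have : 0 ≤ σ x := closure_minimal (convexHull_min h hco) hcl hσ
  rw [hσa] at this
  have : (f v)⁻¹ * f x < 0 := mul_neg_of_pos_of_neg (by positivity) (by linarith)
  linarith

theorem eq_smul_of_le_extremePoint {ρ : WeakDual ℝ V} (hV : IsOrderUnitSpace V (Ici 0) v)
    (hρ : ρ ∈ (stateSpace (Ici 0) v).extremePoints ℝ) {f g : V →L[ℝ] ℝ}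
    (hf : ∀ x, 0 ≤ x → 0 ≤ f x) (hg : ∀ x, 0 ≤ x → 0 ≤ g x) {k : ℝ}
    (hfg : ∀ x, f x + g x = k * ρ x) : ∀ x, f x = f v * ρ x := by
  have zero_of : ∀ f : V →L[ℝ] ℝ, (∀ x, 0 ≤ x → 0 ≤ f x) → f v = 0 → ∀ x, f x = 0 := by
    intro f hf h0 x
    have h₁ := hf _ (sub_nonneg.2 (neg_norm_smul_le hV x))
    have h₂ := hf _ (sub_nonneg.2 (le_norm_smul hV x))
    simp only [map_sub, map_neg, map_smul, smul_eq_mul, h0] at h₁ h₂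
    linarith
  have hρv : ρ v = 1 := hρ.1.2
  have hk : f v + g v = k := by rw [hfg, hρv, mul_one]
  have hv : (0 : V) ≤ v := hV.unit_mem
  rcases (hf v hv).eq_or_lt with hf0 | hf0
  · intro x
    rw [zero_of f hf hf0.symm, ← hf0, zero_mul]
  rcases (hg v hv).eq_or_lt with hg0 | hg0
  · intro x
    have := hfg x
    rw [zero_of g hg hg0.symm, ← hk, ← hg0] at this
    linarith
  have state : ∀ f : V →L[ℝ] ℝ, (∀ x, 0 ≤ x → 0 ≤ f x) → 0 < f v →
      (((f v)⁻¹ • f : V →L[ℝ] ℝ) : WeakDual ℝ V) ∈ stateSpace (Ici 0) v := by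
    intro f hf hv
    refine ⟨fun y hy => ?_, ?_⟩
    · change 0 ≤ (f v)⁻¹ * f y
      have := hf y hy; positivity
    · change (f v)⁻¹ * f v = 1
      exact inv_mul_cancel₀ hv.ne'
  have hk0 : 0 < k := by linarith
  have heq := hρ.2 (state f hf hf0) (state g hg hg0)
    ⟨f v / k, g v / k, by positivity, by positivity, by field_simp; linarith, by
      refine DFunLike.ext _ _ fun x => ?_
      change f v / k * ((f v)⁻¹ * f x) + g v / k * ((g v)⁻¹ * g x) = ρ x
      have := hfg x
      field_simp
      linarith⟩
  intro x
  rw [← heq]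
  change f x = f v * ((f v)⁻¹ * f x)
  field_simp

theorem isDirectedState_of_extremePoint (hV : IsOrderUnitSpace V (Ici 0) v) {ρ : WeakDual ℝ V}
    (hρ : ρ ∈ (stateSpace (Ici 0) v).extremePoints ℝ) :
    IsDirectedState v (ρ : V →L[ℝ] ℝ) := by
  have hρv : ρ v = 1 := hρ.1.2
  have hρ0 : ∀ x : V, 0 ≤ x → 0 ≤ ρ x := hρ.1.1
  refine ⟨hρ0, hρv, fun a b r ha hb => ?_⟩
  change ρ a < r at ha
  change ρ b < r at hb
  by_contra! hno
  let U : Set (V × V) := {p | ∃ c, p.1 ≤ c ∧ p.2 ≤ c ∧ ρ c < r}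
  have hUc : Convex ℝ U := by
    rintro p ⟨c, h₁, h₂, h₃⟩ q ⟨d, h₄, h₅, h₆⟩ s t hs ht hst
    refine ⟨s • c + t • d, ?_, ?_, ?_⟩
    · exact add_le_add (smul_le_smul_of_nonneg_left h₁ hs) (smul_le_smul_of_nonneg_left h₄ ht)
    · exact add_le_add (smul_le_smul_of_nonneg_left h₂ hs) (smul_le_smul_of_nonneg_left h₅ ht)
    · rw [map_add, map_smul, map_smul, smul_eq_mul, smul_eq_mul]
      rcases hs.eq_or_lt with rfl | hs
      · have : t = 1 := by linarith
        simpa [this] using h₆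
      · have : t = 1 - s := by linarith
        subst this
        nlinarith
  have hUo : IsOpen U := by
    rw [Metric.isOpen_iff]
    rintro p ⟨c, h₁, h₂, h₃⟩
    refine ⟨(r - ρ c) / 2, by linarith, fun q hq => ⟨c + ((r - ρ c) / 2) • v, ?_, ?_, ?_⟩⟩
    all_goals try
      rw [Metric.mem_ball, Prod.dist_eq, max_lt_iff, dist_eq_norm, dist_eq_norm] at hq
    · have h := add_le_add h₁ ((le_norm_smul hV (q.1 - p.1)).trans
        (smul_le_smul_of_nonneg_right hq.1.le hV.unit_mem))
      simpa using h
    · have h := add_le_add h₂ ((le_norm_smul hV (q.2 - p.2)).trans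
        (smul_le_smul_of_nonneg_right hq.2.le hV.unit_mem))
      simpa using h
    · rw [map_add, map_smul, hρv, smul_eq_mul]; linarith
  have hab : (a, b) ∉ U := by
    rintro ⟨c, h₁, h₂, h₃⟩
    exact absurd h₃ (not_lt.2 (hno c h₁ h₂))
  obtain ⟨F, hF⟩ := geometric_hahn_banach_open_point hUc hUo hab
  let f := F.comp (ContinuousLinearMap.inl ℝ V V)
  let g := F.comp (ContinuousLinearMap.inr ℝ V V)
  have hFfg : ∀ x y, F (x, y) = f x + g y := by
    intro x y
    simp [f, g, ← map_add]
  have hU : ∀ x y c, x ≤ c → y ≤ c → ρ c < r → f x + g y < f a + g b := by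
    intro x y c h₁ h₂ h₃
    rw [← hFfg, ← hFfg]
    exact hF (x, y) ⟨c, h₁, h₂, h₃⟩
  have hc₀ : ρ ((r - 1) • v) < r := by rw [map_smul, hρv, smul_eq_mul]; linarith
  have nonneg_of : ∀ (z m : ℝ), (∀ n : ℝ, 0 ≤ n → m - n * z < f a + g b) → 0 ≤ z := by
    intro z m h
    by_contra! hz
    have h₀ := h 0 le_rfl
    have := h ((f a + g b - m) / (-z)) (div_nonneg (by linarith) (by linarith))
    have e : (f a + g b - m) / (-z) * z = -(f a + g b - m) := by
      rw [div_neg, neg_mul, div_mul_cancel₀ _ hz.ne]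
    linarith
  have hf : ∀ x, 0 ≤ x → 0 ≤ f x := fun x hx =>
    nonneg_of _ (f ((r - 1) • v) + g ((r - 1) • v)) fun n hn => by
      have := hU ((r - 1) • v - n • x) ((r - 1) • v) _
        (sub_le_self _ (smul_nonneg hn hx)) le_rfl hc₀
      rw [map_sub, map_smul _ n, smul_eq_mul] at this
      linarith
  have hg : ∀ x, 0 ≤ x → 0 ≤ g x := fun x hx =>
    nonneg_of _ (f ((r - 1) • v) + g ((r - 1) • v)) fun n hn => by
      have := hU ((r - 1) • v) ((r - 1) • v - n • x) _
        le_rfl (sub_le_self _ (smul_nonneg hn hx)) hc₀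
      rw [map_sub, map_smul _ n, smul_eq_mul] at this
      linarith
  have hdiag : ∀ c, ρ c < r → f c + g c < f a + g b := fun c h => hU c c c le_rfl le_rfl h
  have hker : ∀ x, ρ x = 0 → 0 ≤ f x + g x := fun x hx =>
    nonneg_of _ (f ((r - 1) • v) + g ((r - 1) • v)) fun n _ => by
      have := hdiag ((r - 1) • v - n • x) (by rw [map_sub, map_smul _ n, hx]; simpa using hc₀)
      rw [map_sub, map_sub, map_smul _ n, map_smul _ n, smul_eq_mul, smul_eq_mul] at this
      linarith
  have hsum : ∀ x, f x + g x = (f v + g v) * ρ x := by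
    intro x
    have h₁ := hker (x - ρ x • v) (by simp [hρv])
    have h₂ := hker (ρ x • v - x) (by simp [hρv])
    simp only [map_sub, map_smul, smul_eq_mul] at h₁ h₂
    linarith
  have hfe := eq_smul_of_le_extremePoint hV hρ hf hg hsum
  have hge := eq_smul_of_le_extremePoint hV hρ hg hf fun x => by
    rw [add_comm, hsum x]
  have hv : (0 : V) ≤ v := hV.unit_mem
  have hfv := hf v hv
  have hgv := hg v hv
  let m := max (ρ a) (ρ b)
  have hm := hdiag (m • v) (by simpa [hρv, m] using ⟨ha, hb⟩)
  rw [hfe a, hge b, map_smul, map_smul, smul_eq_mul, smul_eq_mul] at hm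
  nlinarith [le_max_left (ρ a) (ρ b), le_max_right (ρ a) (ρ b),
    mul_le_mul_of_nonneg_left (le_max_left (ρ a) (ρ b)) hfv,
    mul_le_mul_of_nonneg_left (le_max_right (ρ a) (ρ b)) hgv]

theorem nonneg_of_forall_directedState (hV : IsOrderUnitSpace V (Ici 0) v) {x : V}
    (h : ∀ ρ : V →L[ℝ] ℝ, IsDirectedState v ρ → 0 ≤ ρ x) : 0 ≤ x :=
  nonneg_of_forall_extremePoints hV fun ρ hρ => h ρ (isDirectedState_of_extremePoint hV hρ)

theorem le_of_forall_directedState (hV : IsOrderUnitSpace V (Ici 0) v) {x y : V}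
    (h : ∀ ρ : V →L[ℝ] ℝ, IsDirectedState v ρ → ρ x ≤ ρ y) : x ≤ y :=
  sub_nonneg.1 <| nonneg_of_forall_directedState hV fun ρ hρ => by
    rw [map_sub, sub_nonneg]; exact h ρ hρ

omit [PosSMulMono ℝ V] in
theorem IsDirectedState.mono {ρ : V →L[ℝ] ℝ} (hρ : IsDirectedState v ρ) {x y : V} (h : x ≤ y) :
    ρ x ≤ ρ y := by
  have := hρ.nonneg _ (sub_nonneg.2 h)
  rwa [map_sub, sub_nonneg] at this

end States

section Cone

variable {V : Type*} [NormedAddCommGroup V] [NormedSpace ℝ V] [PartialOrder V]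
  [IsOrderedAddMonoid V] [PosSMulMono ℝ V] {v : V}

/-- The open cone of an order unit space whose cone is the set of nonnegative elements. -/
abbrev posCone (v : V) : Set V := openCone (Ici 0) v

omit [PosSMulMono ℝ V] in
theorem posCone_of_le {x y : V} (hx : x ∈ posCone v) (h : x ≤ y) : y ∈ posCone v := by
  obtain ⟨ε, hε, hx⟩ := hx
  exact ⟨ε, hε, (mem_Ici.1 hx).trans (sub_le_sub_right h _)⟩

omit [IsOrderedAddMonoid V] in
theorem smul_mem_posCone {x : V} (hx : x ∈ posCone v) {r : ℝ} (hr : 0 < r) :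
    r • x ∈ posCone v := by
  obtain ⟨ε, hε, hx⟩ := hx
  refine ⟨r * ε, by positivity, ?_⟩
  rw [mul_smul, ← smul_sub]
  exact smul_nonneg hr.le hx

theorem nonneg_of_mem_posCone (hV : IsOrderUnitSpace V (Ici 0) v) {x : V} (hx : x ∈ posCone v) :
    0 ≤ x := by
  obtain ⟨ε, hε, hx⟩ := hx
  exact (smul_nonneg hε.le (mem_Ici.1 hV.unit_mem)).trans (sub_nonneg.1 hx)

theorem add_mem_posCone (hV : IsOrderUnitSpace V (Ici 0) v) {x y : V} (hx : x ∈ posCone v)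
    (hy : y ∈ posCone v) : x + y ∈ posCone v :=
  posCone_of_le hx (le_add_of_nonneg_right (nonneg_of_mem_posCone hV hy))

omit [IsOrderedAddMonoid V] [PosSMulMono ℝ V] in
theorem unit_mem_posCone : v ∈ posCone v := ⟨1, one_pos, by simp⟩

theorem exists_smul_le (hV : IsOrderUnitSpace V (Ici 0) v) (x : V) {y : V}
    (hy : y ∈ posCone v) : ∃ δ : ℝ, 0 < δ ∧ δ < 1 ∧ δ • x ≤ y := by
  obtain ⟨ε, hε, hy⟩ := hy
  obtain ⟨r, hr, hx⟩ := hV.unit_order x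
  have hm : min (ε / r) 2⁻¹ * r ≤ ε := by
    rw [← le_div_iff₀ hr]; exact min_le_left _ _
  refine ⟨min (ε / r) 2⁻¹, by positivity, by
    linarith [min_le_right (ε / r) (2⁻¹ : ℝ)], ?_⟩
  refine (smul_le_smul_of_nonneg_left (sub_nonneg.1 (mem_Ici.1 hx)) (by positivity)).trans ?_
  rw [smul_smul]
  exact (smul_le_smul_of_nonneg_right hm hV.unit_mem).trans (sub_nonneg.1 (mem_Ici.1 hy))

omit [IsOrderedAddMonoid V] [PosSMulMono ℝ V] in
theorem IsDirectedState.pos {ρ : V →L[ℝ] ℝ} (hρ : IsDirectedState v ρ) {x : V}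
    (hx : x ∈ posCone v) : 0 < ρ x := by
  obtain ⟨ε, hε, hx⟩ := hx
  have := hρ.nonneg _ hx
  rw [map_sub, map_smul, hρ.unit, smul_eq_mul] at this
  linarith

theorem eq_of_forall_directedState (hV : IsOrderUnitSpace V (Ici 0) v) {x y : V}
    (h : ∀ ρ : V →L[ℝ] ℝ, IsDirectedState v ρ → ρ x = ρ y) : x = y :=
  le_antisymm (le_of_forall_directedState hV fun ρ hρ => (h ρ hρ).le)
    (le_of_forall_directedState hV fun ρ hρ => (h ρ hρ).ge)

end Cone

section Gauge

variable {V : Type*} [NormedAddCommGroup V] [NormedSpace ℝ V] [PartialOrder V]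
  [IsOrderedAddMonoid V] [PosSMulMono ℝ V] {v : V}
variable {W : Type*} [NormedAddCommGroup W] [NormedSpace ℝ W] [PartialOrder W]
  [IsOrderedAddMonoid W] [PosSMulMono ℝ W] {w : W} {Φ : V → W} {Ψ : W → V}

/-- `Φ` and `Ψ` are mutually inverse gauge-reversing bijections between open cones. -/
structure GaugePair (v : V) (w : W) (Φ : V → W) (Ψ : W → V) : Prop where
  mapsTo : ∀ x ∈ posCone v, Φ x ∈ posCone w
  mapsTo_symm : ∀ y ∈ posCone w, Ψ y ∈ posCone v
  left_inv : ∀ x ∈ posCone v, Ψ (Φ x) = x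
  right_inv : ∀ y ∈ posCone w, Φ (Ψ y) = y
  smul : ∀ x ∈ posCone v, ∀ r : ℝ, 0 < r → Φ (r • x) = r⁻¹ • Φ x
  anti : ∀ x ∈ posCone v, ∀ y ∈ posCone v, x ≤ y → Φ y ≤ Φ x
  anti_symm : ∀ x ∈ posCone w, ∀ y ∈ posCone w, x ≤ y → Ψ y ≤ Ψ x

namespace GaugePair

omit [IsOrderedAddMonoid V] [IsOrderedAddMonoid W] [PosSMulMono ℝ W] in
theorem symm (h : GaugePair v w Φ Ψ) : GaugePair w v Ψ Φ where
  mapsTo := h.mapsTo_symm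
  mapsTo_symm := h.mapsTo
  left_inv := h.right_inv
  right_inv := h.left_inv
  smul y hy r hr := by
    have h₁ := h.mapsTo_symm y hy
    rw [← h.left_inv _ (smul_mem_posCone h₁ (inv_pos.2 hr)), h.smul _ h₁ _ (inv_pos.2 hr),
      h.right_inv y hy, inv_inv]
  anti := h.anti_symm
  anti_symm := h.anti

omit [IsOrderedAddMonoid V] [PosSMulMono ℝ V] [IsOrderedAddMonoid W] [PosSMulMono ℝ W] in
theorem le_of_le (h : GaugePair v w Φ Ψ) {x y : V} (hx : x ∈ posCone v) (hy : y ∈ posCone v)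
    (hxy : Φ y ≤ Φ x) : x ≤ y := by
  simpa [h.left_inv, hx, hy] using
    h.anti_symm _ (h.mapsTo y hy) _ (h.mapsTo x hx) hxy

omit [IsOrderedAddMonoid V] [PosSMulMono ℝ V] [PosSMulMono ℝ W] in
theorem exists_le_le (h : GaugePair v w Φ Ψ) {ρ : W →L[ℝ] ℝ} (hρ : IsDirectedState w ρ)
    {y z : V} (hy : y ∈ posCone v) (hz : z ∈ posCone v) {r : ℝ} (hyr : ρ (Φ y) < r)
    (hzr : ρ (Φ z) < r) : ∃ a ∈ posCone v, a ≤ y ∧ a ≤ z ∧ ρ (Φ a) < r := by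
  obtain ⟨c, h₁, h₂, h₃⟩ := hρ.directed _ _ _ hyr hzr
  have hc := posCone_of_le (h.mapsTo y hy) h₁
  refine ⟨Ψ c, h.mapsTo_symm c hc, h.le_of_le (h.mapsTo_symm c hc) hy ?_,
    h.le_of_le (h.mapsTo_symm c hc) hz ?_, ?_⟩
  all_goals rwa [h.right_inv c hc]

omit [IsOrderedAddMonoid V] [PosSMulMono ℝ V] in
/-- An order embedding of the open cone lying below the identity acts monotonically on the
values of `ρ ∘ Φ`, for every directed state `ρ`. -/
theorem state_le_of_state_lt (hW : IsOrderUnitSpace W (Ici 0) w) (h : GaugePair v w Φ Ψ)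
    {ρ : W →L[ℝ] ℝ} (hρ : IsDirectedState w ρ) {α : V → V}
    (hα : ∀ y ∈ posCone v, α y ∈ posCone v) (hle : ∀ y ∈ posCone v, α y ≤ y)
    (hiff : ∀ y ∈ posCone v, ∀ z ∈ posCone v, α y ≤ α z ↔ y ≤ z)
    {y z : V} (hy : y ∈ posCone v) (hz : z ∈ posCone v) (hyz : ρ (Φ y) < ρ (Φ z)) :
    ρ (Φ (α y)) ≤ ρ (Φ (α z)) := by
  by_contra! hlt
  have hpos := hρ.pos (h.mapsTo _ (hα y hy))
  have hRpos := hρ.pos (h.mapsTo _ hz)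
  have hcpos := hρ.pos (h.mapsTo _ (hα z hz))
  set b := Φ (α y)
  set c := Φ (α z)
  obtain ⟨s, hs₁, hs₂⟩ := exists_between ((div_lt_one hpos).2 hlt)
  have hs₀ : 0 < s := lt_trans (by positivity) hs₁
  rw [div_lt_iff₀ hpos] at hs₁
  have hg : ρ ((1 - s)⁻¹ • (c - s • b)) < ρ (Φ z) := by
    refine lt_trans ?_ hRpos
    rw [map_smul, map_sub, map_smul, smul_eq_mul, smul_eq_mul]
    exact mul_neg_of_pos_of_neg (inv_pos.2 (by linarith)) (by linarith)
  have hu : ρ ((ρ (Φ z) / 2) • w) < ρ (Φ z) := by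
    rw [map_smul, hρ.unit, smul_eq_mul]; linarith
  obtain ⟨d, hgd, hud, hd⟩ := hρ.directed _ _ _ hg hu
  have hdC : d ∈ posCone w :=
    posCone_of_le (smul_mem_posCone unit_mem_posCone (half_pos hRpos)) hud
  obtain ⟨a, ha, hay, had, haR⟩ := h.exists_le_le hρ hy (h.mapsTo_symm d hdC) hyz
    (by rwa [h.right_inv d hdC])
  have h₁ : b ≤ Φ (α a) := h.anti _ (hα a ha) _ (hα y hy) ((hiff a ha y hy).2 hay)
  have h₂ : d ≤ Φ (α a) := by
    rw [← h.right_inv d hdC]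
    exact h.anti _ (hα a ha) _ (h.mapsTo_symm d hdC) ((hle a ha).trans had)
  have h₃ : c ≤ Φ (α a) := by
    refine le_of_forall_directedState hW fun σ hσ => ?_
    have e₁ := hσ.mono h₁
    have e₂ := hσ.mono (hgd.trans h₂)
    rw [map_smul, map_sub, map_smul, smul_eq_mul, smul_eq_mul,
      inv_mul_le_iff₀ (by linarith)] at e₂
    nlinarith
  have h₄ : a ≤ z := (hiff a ha z hz).1 (h.le_of_le (hα a ha) (hα z hz) h₃)
  exact (hρ.mono (h.anti _ ha _ hz h₄)).not_gt haR

omit [IsOrderedAddMonoid W] [PosSMulMono ℝ W] in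
theorem exists_map_add_le (hV : IsOrderUnitSpace V (Ici 0) v)
    (h : GaugePair v w Φ Ψ) {x y : V} (hx : x ∈ posCone v) (hy : y ∈ posCone v) :
    ∃ c : ℝ, 0 < c ∧ c < 1 ∧ Φ (x + y) ≤ c • Φ x := by
  obtain ⟨δ, hδ, -, hxy⟩ := exists_smul_le hV x hy
  refine ⟨(1 + δ)⁻¹, by positivity, inv_lt_one_of_one_lt₀ (by linarith), ?_⟩
  rw [← h.smul x hx _ (by positivity)]
  refine h.anti _ (smul_mem_posCone hx (by positivity)) _ (add_mem_posCone hV hx hy) ?_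
  rw [add_smul, one_smul]
  gcongr

omit [IsOrderedAddMonoid W] in
/-- If `d` is strictly below `Φ x` then `Ψ d` is strictly above `x`. -/
theorem sub_mem_posCone (h : GaugePair v w Φ Ψ) {x : V} (hx : x ∈ posCone v) {d : W}
    (hd : d ∈ posCone w) {c : ℝ} (hc : 0 < c) (hc1 : c < 1) (hdc : d ≤ c • Φ x) :
    Ψ d - x ∈ posCone v := by
  have h₁ := h.anti_symm _ hd _ (smul_mem_posCone (h.mapsTo x hx) hc) hdc
  rw [h.symm.smul _ (h.mapsTo x hx) c hc, h.left_inv x hx] at h₁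
  refine posCone_of_le (smul_mem_posCone hx (r := c⁻¹ - 1) ?_) ?_
  · rw [sub_pos]; exact one_lt_inv_iff₀.2 ⟨hc, hc1⟩
  · rw [sub_smul, one_smul]; exact sub_le_sub_right h₁ _

theorem map_add_smul_combination (hV : IsOrderUnitSpace V (Ici 0) v)
    (hW : IsOrderUnitSpace W (Ici 0) w)
    (h : GaugePair v w Φ Ψ) {x y : V} (hx : x ∈ posCone v) (hy : y ∈ posCone v) {t : ℝ}
    (ht : 0 < t) (ht1 : t < 1) :
    Φ (x + Ψ (t⁻¹ • (Φ y + (1 - t) • Φ x))) = (1 - t) • Φ x + t • Φ (x + y) := by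
  have ht' : 0 < 1 - t := by linarith
  have hxy : ∀ y ∈ posCone v, x + y ∈ posCone v := fun y hy => add_mem_posCone hV hx hy
  have hΦx := h.mapsTo x hx
  let e : V → W := fun y => (1 - t) • Φ x + t • Φ (x + y)
  have he : ∀ y ∈ posCone v, e y ∈ posCone w := fun y hy =>
    add_mem_posCone hW (smul_mem_posCone hΦx ht')
      (smul_mem_posCone (h.mapsTo _ (hxy y hy)) ht)
  have he_le : ∀ y ∈ posCone v, ∀ z ∈ posCone v, e z ≤ e y ↔ y ≤ z := by
    intro y hy z hz
    constructor
    · intro hzy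
      have h₁ : Φ (x + z) ≤ Φ (x + y) :=
        le_of_smul_le_smul_left (le_of_add_le_add_left hzy) ht
      exact le_of_add_le_add_left (h.le_of_le (hxy y hy) (hxy z hz) h₁)
    · intro hyz
      exact add_le_add_right (smul_le_smul_of_nonneg_left
        (h.anti _ (hxy y hy) _ (hxy z hz) (add_le_add_right hyz _)) ht.le) _
  let α : V → V := fun y => Ψ (e y) - x
  have hα : ∀ y ∈ posCone v, α y ∈ posCone v := by
    intro y hy
    obtain ⟨c, hc, hc1, hle⟩ := h.exists_map_add_le hV hx hy
    refine h.sub_mem_posCone hx (he y hy) (c := 1 - t + t * c) (by positivity) (by nlinarith) ?_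
    rw [add_smul, mul_smul]
    exact add_le_add_right (smul_le_smul_of_nonneg_left hle ht.le) _
  have hle : ∀ y ∈ posCone v, α y ≤ y := by
    intro y hy
    rw [sub_le_iff_le_add']
    refine h.le_of_le (h.mapsTo_symm _ (he y hy)) (hxy y hy) ?_
    rw [h.right_inv _ (he y hy)]
    have h₁ : Φ (x + y) ≤ Φ x :=
      h.anti _ hx _ (hxy y hy) (le_add_of_nonneg_right (nonneg_of_mem_posCone hV hy))
    calc Φ (x + y) = (1 - t) • Φ (x + y) + t • Φ (x + y) := by module
      _ ≤ e y := add_le_add_left (smul_le_smul_of_nonneg_left h₁ ht'.le) _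
  have hiff : ∀ y ∈ posCone v, ∀ z ∈ posCone v, α y ≤ α z ↔ y ≤ z := by
    intro y hy z hz
    rw [sub_le_sub_iff_right, ← he_le y hy z hz]
    exact ⟨h.symm.le_of_le (he z hz) (he y hy), h.anti_symm _ (he z hz) _ (he y hy)⟩
  have hray : ∀ k : ℝ, 0 < k → Φ (α (k • x)) = ((k⁻¹ + (1 - t)) / t) • Φ x := by
    intro k hk
    have hc : 0 < 1 - t + t * (1 + k)⁻¹ := by positivity
    have h₁ : e (k • x) = (1 - t + t * (1 + k)⁻¹) • Φ x := by
      have : x + k • x = (1 + k) • x := by module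
      simp only [e]
      rw [this, h.smul x hx _ (by positivity)]
      module
    have h₂ : α (k • x) = ((1 - t + t * (1 + k)⁻¹)⁻¹ - 1) • x := by
      simp only [α]
      rw [h₁, h.symm.smul _ hΦx _ hc, h.left_inv x hx]
      module
    have hne : 1 + k - t * k ≠ 0 := by nlinarith
    have h₃ : (1 - t + t * (1 + k)⁻¹)⁻¹ - 1 = ((k⁻¹ + (1 - t)) / t)⁻¹ := by
      have e₁ : 1 - t + t * (1 + k)⁻¹ = (1 + k - t * k) / (1 + k) := by field_simp; ring
      have e₂ : (k⁻¹ + (1 - t)) / t = (1 + k - t * k) / (t * k) := by field_simp; ring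
      rw [e₁, e₂, inv_div, inv_div, div_sub_one hne]; congr 1; ring
    rw [h₂, h₃, h.smul x hx _ (by positivity), inv_inv]
  have hΦα : Φ (α y) = t⁻¹ • (Φ y + (1 - t) • Φ x) := by
    refine eq_of_forall_directedState hW fun ρ hρ => ?_
    have hr := hρ.pos hΦx
    have hq := hρ.pos (h.mapsTo y hy)
    rw [map_smul, map_add, map_smul, smul_eq_mul, smul_eq_mul]
    set r := ρ (Φ x)
    set q := ρ (Φ y)
    have hk : ∀ p : ℝ, 0 < p → ρ (Φ ((r / p) • x)) = p := by
      intro p hp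
      rw [h.smul x hx _ (by positivity), map_smul, smul_eq_mul]
      change (r / p)⁻¹ * r = p
      field_simp
    have hαk : ∀ p : ℝ, 0 < p → ρ (Φ (α ((r / p) • x))) = t⁻¹ * (p + (1 - t) * r) := by
      intro p hp
      rw [hray _ (by positivity), map_smul, smul_eq_mul]
      change ((r / p)⁻¹ + (1 - t)) / t * r = _
      field_simp
    refine le_antisymm (le_of_forall_pos_le_add fun ε hε => ?_)
      (le_of_forall_pos_le_add fun ε hε => ?_)
    · have hp : 0 < q + t * ε := by positivity
      have := h.state_le_of_state_lt hW hρ hα hle hiff hy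
        (smul_mem_posCone hx (div_pos hr hp)) (by rw [hk _ hp]; change q < _; nlinarith)
      rw [hαk _ hp] at this
      refine this.trans_eq ?_
      field_simp
      ring
    · have hp : 0 < max (q - t * ε) (q / 2) := lt_max_of_lt_right (by positivity)
      have := h.state_le_of_state_lt hW hρ hα hle hiff
        (smul_mem_posCone hx (div_pos hr hp)) hy (by
          rw [hk _ hp]; exact max_lt (by nlinarith) (by linarith))
      rw [hαk _ hp] at this
      have h₁ : t⁻¹ * (q - t * ε + (1 - t) * r) ≤
          t⁻¹ * (max (q - t * ε) (q / 2) + (1 - t) * r) := by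
        gcongr; exact le_max_left _ _
      have h₂ : t⁻¹ * (q - t * ε + (1 - t) * r) = t⁻¹ * (q + (1 - t) * r) - ε := by
        field_simp; ring
      linarith
  rw [← hΦα, h.left_inv _ (hα y hy)]
  simp only [α]
  rw [add_sub_cancel, h.right_inv _ (he y hy)]

end GaugePair

end Gauge

section Preserving

variable {V : Type*} [NormedAddCommGroup V] [NormedSpace ℝ V] [PartialOrder V]
  [IsOrderedAddMonoid V] [PosSMulMono ℝ V] {v : V}
variable {W : Type*} [NormedAddCommGroup W] [NormedSpace ℝ W] [PartialOrder W]
  [IsOrderedAddMonoid W] [PosSMulMono ℝ W] {w : W} {f : V → W}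

omit [PosSMulMono ℝ V] [PosSMulMono ℝ W] in
theorem GaugePreserving.le_iff (hf : GaugePreserving (Ici 0) v (Ici 0) w f) {x y : V}
    (hx : x ∈ posCone v) (hy : y ∈ posCone v) : f x ≤ f y ↔ x ≤ y := by
  simpa using (hf.2.2 x hx y hy).symm

omit [IsOrderedAddMonoid V] [IsOrderedAddMonoid W] [PosSMulMono ℝ W] in
theorem GaugePreserving.symm (hf : GaugePreserving (Ici 0) v (Ici 0) w f) :
    GaugePreserving (Ici 0) w (Ici 0) v (Function.invFunOn f (posCone v)) := by
  have hinv := hf.1.invOn_invFunOn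
  have hmaps := hf.1.surjOn.mapsTo_invFunOn
  refine ⟨hf.1.symm hinv.symm, fun y hy r hr => ?_, fun y hy z hz => ?_⟩
  · have h₁ := smul_mem_posCone (hmaps hy) hr
    rw [← hinv.1 h₁, hf.2.1 _ (hmaps hy) r hr, hinv.2 hy]
  · have := hf.2.2 _ (hmaps hy) _ (hmaps hz)
    rw [hinv.2 hy, hinv.2 hz] at this
    exact this.symm

theorem GaugePreserving.map_add_le (hV : IsOrderUnitSpace V (Ici 0) v)
    (hW : IsOrderUnitSpace W (Ici 0) w) (hf : GaugePreserving (Ici 0) v (Ici 0) w f) {a b : V}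
    (ha : a ∈ posCone v) (hb : b ∈ posCone v) : f (a + b) ≤ f a + f b := by
  refine le_of_forall_directedState hW fun ρ hρ => ?_
  have key : ∀ ε : ℝ, 0 < ε → ρ (f (a + b)) ≤ (ρ (f a) + ε) + (ρ (f b) + ε) := by
    intro ε hε
    have hpa := hρ.pos (hf.1.mapsTo ha)
    have hpb := hρ.pos (hf.1.mapsTo hb)
    obtain ⟨d, h₁, h₂, h₃⟩ := hρ.directed ((ρ (f a) + ε)⁻¹ • f a) ((ρ (f b) + ε)⁻¹ • f b) 1
      (by rw [map_smul, smul_eq_mul, inv_mul_lt_iff₀ (by positivity)]; linarith)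
      (by rw [map_smul, smul_eq_mul, inv_mul_lt_iff₀ (by positivity)]; linarith)
    have hd : d ∈ posCone w :=
      posCone_of_le (smul_mem_posCone (hf.1.mapsTo ha) (inv_pos.2 (by positivity))) h₁
    obtain ⟨g, hg, rfl⟩ := hf.1.surjOn hd
    have le_smul : ∀ c ∈ posCone v, ∀ r : ℝ, 0 < r → r⁻¹ • f c ≤ f g → c ≤ r • g := by
      intro c hc r hr hle
      rw [← hf.2.1 c hc _ (inv_pos.2 hr), GaugePreserving.le_iff hf
        (smul_mem_posCone hc (inv_pos.2 hr)) hg] at hle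
      have := smul_le_smul_of_nonneg_left hle hr.le
      rwa [smul_inv_smul₀ hr.ne'] at this
    have hab : a + b ≤ ((ρ (f a) + ε) + (ρ (f b) + ε)) • g := by
      rw [add_smul]
      exact add_le_add (le_smul a ha _ (by positivity) h₁) (le_smul b hb _ (by positivity) h₂)
    have hr : 0 < (ρ (f a) + ε) + (ρ (f b) + ε) := by positivity
    rw [← GaugePreserving.le_iff hf (add_mem_posCone hV ha hb) (smul_mem_posCone hg hr),
      hf.2.1 g hg _ hr] at hab
    have := hρ.mono hab
    rw [map_smul, smul_eq_mul] at this
    nlinarith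
  rw [map_add]
  refine le_of_forall_pos_le_add fun ε hε => ?_
  linarith [key (ε / 2) (half_pos hε)]

theorem GaugePreserving.map_add (hV : IsOrderUnitSpace V (Ici 0) v)
    (hW : IsOrderUnitSpace W (Ici 0) w) (hf : GaugePreserving (Ici 0) v (Ici 0) w f) {a b : V}
    (ha : a ∈ posCone v) (hb : b ∈ posCone v) : f (a + b) = f a + f b := by
  refine le_antisymm (GaugePreserving.map_add_le hV hW hf ha hb) ?_
  have hinv := hf.1.invOn_invFunOn
  have hmaps := hf.1.surjOn.mapsTo_invFunOn
  have hfa := hf.1.mapsTo ha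
  have hfb := hf.1.mapsTo hb
  have hfab := add_mem_posCone hW hfa hfb
  have := GaugePreserving.map_add_le hW hV (GaugePreserving.symm hf) hfa hfb
  rwa [hinv.1 ha, hinv.1 hb, ← GaugePreserving.le_iff hf (hmaps hfab) (add_mem_posCone hV ha hb),
    hinv.2 hfab] at this

/-- A gauge-preserving bijection between open cones extends to a bounded linear map. -/
theorem GaugePreserving.exists_continuousLinearMap (hV : IsOrderUnitSpace V (Ici 0) v)
    (hW : IsOrderUnitSpace W (Ici 0) w) (hf : GaugePreserving (Ici 0) v (Ici 0) w f) :
    ∃ A : V →L[ℝ] W, ∀ x ∈ posCone v, A x = f x := by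
  have hadd : ∀ a ∈ posCone v, ∀ b ∈ posCone v, f (a + b) = f a + f b :=
    fun a ha b hb => GaugePreserving.map_add hV hW hf ha hb
  have huC : ∀ k : ℝ, 0 < k → k • v ∈ posCone v := fun k hk => smul_mem_posCone unit_mem_posCone hk
  have hshift : ∀ h : V, ∀ k : ℝ, ‖h‖ < k → h + k • v ∈ posCone v := fun h k hk =>
    ⟨k - ‖h‖, sub_pos.2 hk, by
      have := neg_le_iff_add_nonneg.1 (neg_norm_smul_le hV h)
      rw [mem_Ici]; convert this using 1; module⟩
  have hk0 : ∀ h : V, 0 < ‖h‖ + 1 := fun h => by positivity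
  let F : V → W := fun h => f (h + (‖h‖ + 1) • v) - f ((‖h‖ + 1) • v)
  have hF : ∀ h : V, ∀ a ∈ posCone v, ∀ b ∈ posCone v, a = h + b → F h = f a - f b := by
    rintro h _ ha b hb rfl
    have h₁ := hadd _ (hshift h _ (lt_add_one _)) _ hb
    have h₂ := hadd _ ha _ (huC _ (hk0 h))
    rw [show h + (‖h‖ + 1) • v + b = h + b + (‖h‖ + 1) • v by abel, h₂] at h₁
    rw [sub_eq_sub_iff_add_eq_add, h₁]
  have hFC : ∀ x ∈ posCone v, F x = f x := fun x hx => by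
    rw [hF x (x + v) (add_mem_posCone hV hx unit_mem_posCone) v unit_mem_posCone rfl,
      hadd x hx v unit_mem_posCone, add_sub_cancel_right]
  have hFadd : ∀ x y, F (x + y) = F x + F y := by
    intro x y
    have hx := hshift x _ (lt_add_one _)
    have hy := hshift y _ (lt_add_one _)
    have hx' := huC _ (hk0 x)
    have hy' := huC _ (hk0 y)
    rw [hF (x + y) _ (add_mem_posCone hV hx hy) _ (add_mem_posCone hV hx' hy') (by abel),
      hadd _ hx _ hy, hadd _ hx' _ hy']
    simp only [F]
    abel
  have hFneg : ∀ x, F (-x) = -F x := by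
    intro x
    have h0 : F 0 = 0 := by simpa using hFadd 0 0
    rw [eq_neg_iff_add_eq_zero, ← hFadd, neg_add_cancel, h0]
  have hFpos : ∀ r : ℝ, 0 < r → ∀ x, F (r • x) = r • F x := by
    intro r hr x
    have hx := hshift x _ (lt_add_one _)
    have hx' := huC _ (hk0 x)
    rw [hF (r • x) _ (smul_mem_posCone hx hr) _ (smul_mem_posCone hx' hr) (by rw [smul_add]),
      hf.2.1 _ hx r hr, hf.2.1 _ hx' r hr, ← smul_sub]
  have hFsmul : ∀ (r : ℝ) x, F (r • x) = r • F x := by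
    intro r x
    rcases lt_trichotomy r 0 with hr | rfl | hr
    · have := hFpos (-r) (neg_pos.2 hr) x
      rwa [neg_smul, hFneg, neg_smul, neg_inj] at this
    · rw [zero_smul, zero_smul]; simpa using hFadd 0 0
    · exact hFpos r hr x
  have hmono : ∀ h : V, ∀ k : ℝ, ‖h‖ < k → F h ≤ k • f v := by
    intro h k hk
    have hk' : 0 < k := (norm_nonneg h).trans_lt hk
    have hle : h ≤ k • v := (le_norm_smul hV h).trans
      (smul_le_smul_of_nonneg_right hk.le hV.unit_mem)
    have h₁ : f (h + k • v) ≤ f (k • v + k • v) :=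
      (GaugePreserving.le_iff hf (hshift h k hk)
        (add_mem_posCone hV (huC k hk') (huC k hk'))).2 (add_le_add_left hle _)
    rw [hadd _ (huC k hk') _ (huC k hk'), hf.2.1 v unit_mem_posCone k hk'] at h₁
    rw [hF h _ (hshift h k hk) _ (huC k hk') rfl, hf.2.1 v unit_mem_posCone k hk']
    exact sub_le_iff_le_add.2 h₁
  let A : V →ₗ[ℝ] W := { toFun := F, map_add' := hFadd, map_smul' := hFsmul }
  refine ⟨A.mkContinuous ‖f v‖ fun h => ?_, hFC⟩
  change ‖F h‖ ≤ _
  have hb : ∀ h : V, ∀ k : ℝ, ‖h‖ < k → F h ≤ (k * ‖f v‖) • w := fun h k hk => by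
    rw [mul_smul]
    exact (hmono h k hk).trans
      (smul_le_smul_of_nonneg_left (le_norm_smul hW _) ((norm_nonneg h).trans hk.le))
  have hbound : ∀ k : ℝ, ‖h‖ < k → ‖F h‖ ≤ k * ‖f v‖ := by
    intro k hk
    have hk' : 0 ≤ k := (norm_nonneg h).trans hk.le
    refine norm_le_of_abs_le hW (by positivity) ?_ (hb h k hk)
    rw [neg_le, ← hFneg]
    exact hb (-h) k (by rwa [norm_neg])
  have hlim : Filter.Tendsto (fun k : ℝ => k * ‖f v‖) (𝓝[>] ‖h‖) (𝓝 (‖h‖ * ‖f v‖)) :=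
    ((continuous_id.mul continuous_const).tendsto _).mono_left nhdsWithin_le_nhds
  rw [mul_comm]
  exact ge_of_tendsto hlim (Filter.eventually_of_mem self_mem_nhdsWithin hbound)

end Preserving

section Derivative

variable {V : Type*} [NormedAddCommGroup V] [NormedSpace ℝ V] [PartialOrder V]
  [IsOrderedAddMonoid V] [PosSMulMono ℝ V] {v : V}
variable {W : Type*} [NormedAddCommGroup W] [NormedSpace ℝ W] [PartialOrder W]
  [IsOrderedAddMonoid W] [PosSMulMono ℝ W] {w : W} {Φ : V → W} {Ψ : W → V}

/-- The difference quotient `t⁻¹ • (Φ x - Φ (x + y))`, where `Φ y = t⁻¹ • Φ z - Φ x`. -/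
noncomputable def harmonicQuotient (Φ : V → W) (Ψ : W → V) (x : V) (t : ℝ) (z : V) : W :=
  t⁻¹ • (Φ x - Φ (x + Ψ (t⁻¹ • Φ z - Φ x)))

namespace GaugePair

theorem harmonicQuotient_mul (hV : IsOrderUnitSpace V (Ici 0) v)
    (hW : IsOrderUnitSpace W (Ici 0) w) (h : GaugePair v w Φ Ψ) {x z : V} (hx : x ∈ posCone v)
    {s t : ℝ} (hs : 0 < s) (hs1 : s < 1)
    (hadm : t⁻¹ • Φ z - Φ x ∈ posCone w) :
    harmonicQuotient Φ Ψ x (s * t) z = harmonicQuotient Φ Ψ x t z := by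
  have := h.map_add_smul_combination hV hW hx (h.mapsTo_symm _ hadm) hs hs1
  rw [h.right_inv _ hadm] at this
  have e : (s * t)⁻¹ • Φ z - Φ x = s⁻¹ • (t⁻¹ • Φ z - Φ x + (1 - s) • Φ x) := by
    rw [mul_inv, mul_smul, sub_smul, one_smul, smul_add, smul_sub, smul_sub, smul_smul s⁻¹ s,
      inv_mul_cancel₀ hs.ne', one_smul]
    abel
  unfold harmonicQuotient
  rw [e, this, mul_inv, mul_comm, mul_smul]
  congr 1
  rw [show ∀ a b : W, a - ((1 - s) • a + s • b) = s • (a - b) from fun a b => by module,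
    smul_smul, inv_mul_cancel₀ hs.ne', one_smul]

theorem harmonicQuotient_eq (hV : IsOrderUnitSpace V (Ici 0) v)
    (hW : IsOrderUnitSpace W (Ici 0) w) (h : GaugePair v w Φ Ψ) {x z : V} (hx : x ∈ posCone v)
    {s t : ℝ} (hs : 0 < s) (ht : 0 < t) (hadm : s⁻¹ • Φ z - Φ x ∈ posCone w)
    (hadm' : t⁻¹ • Φ z - Φ x ∈ posCone w) :
    harmonicQuotient Φ Ψ x s z = harmonicQuotient Φ Ψ x t z := by
  have hpos : 0 < s + t := by positivity
  rw [← h.harmonicQuotient_mul hV hW hx (div_pos ht hpos)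
      ((div_lt_one hpos).2 (by linarith)) hadm,
    ← h.harmonicQuotient_mul hV hW hx (div_pos hs hpos)
      ((div_lt_one hpos).2 (by linarith)) hadm']
  congr 1
  ring

omit [IsOrderedAddMonoid V] [PosSMulMono ℝ V] in
theorem inv_smul_sub_mem (h : GaugePair v w Φ Ψ) {x z : V} (hx : x ∈ posCone v) {δ t : ℝ}
    (hle : δ • Φ x ≤ Φ z) (ht : 0 < t) (htδ : t < δ) : t⁻¹ • Φ z - Φ x ∈ posCone w := by
  refine posCone_of_le (smul_mem_posCone (h.mapsTo x hx) (r := t⁻¹ * δ - 1) ?_) ?_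
  · rw [sub_pos, inv_mul_eq_div, one_lt_div ht]; exact htδ
  · rw [sub_smul, one_smul, mul_smul]
    exact sub_le_sub_right (smul_le_smul_of_nonneg_left hle (inv_nonneg.2 ht.le)) _

/-- The harmonic quotients at `x` define a gauge-preserving bijection satisfying Hua's identity. -/
theorem exists_gaugePreserving (hV : IsOrderUnitSpace V (Ici 0) v)
    (hW : IsOrderUnitSpace W (Ici 0) w) (h : GaugePair v w Φ Ψ) {x : V} (hx : x ∈ posCone v) :
    ∃ L : V → W, GaugePreserving (Ici 0) v (Ici 0) w L ∧ L x = Φ x ∧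
      ∀ y ∈ posCone v, L (Ψ (Φ x + Φ y)) = Φ x - Φ (x + y) := by
  have hΦx := h.mapsTo x hx
  have hex : ∀ z : V, z ∈ posCone v → ∃ t : ℝ, 0 < t ∧ t⁻¹ • Φ z - Φ x ∈ posCone w := by
    intro z hz
    obtain ⟨δ, hδ, -, hle⟩ := exists_smul_le hW (Φ x) (h.mapsTo z hz)
    exact ⟨δ / 2, half_pos hδ, h.inv_smul_sub_mem hx hle (half_pos hδ) (half_lt_self hδ)⟩
  choose! τ hτ hτadm using hex
  let L : V → W := fun z => harmonicQuotient Φ Ψ x (τ z) z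
  have hL : ∀ z ∈ posCone v, ∀ t : ℝ, 0 < t → t⁻¹ • Φ z - Φ x ∈ posCone w →
      L z = harmonicQuotient Φ Ψ x t z := fun z hz t ht hadm =>
    h.harmonicQuotient_eq hV hW hx (hτ z hz) ht (hτadm z hz) hadm
  have hL' : ∀ z ∈ posCone v, ∀ y ∈ posCone v, ∀ t : ℝ, 0 < t → t⁻¹ • Φ z = Φ x + Φ y →
      L z = t⁻¹ • (Φ x - Φ (x + y)) := by
    intro z hz y hy t ht e
    have e' : t⁻¹ • Φ z - Φ x = Φ y := by rw [e, add_sub_cancel_left]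
    rw [hL z hz t ht (e' ▸ h.mapsTo y hy), harmonicQuotient, e', h.left_inv y hy]
  have hmaps : MapsTo L (posCone v) (posCone w) := by
    intro z hz
    obtain ⟨c, hc, hc1, hle⟩ := h.exists_map_add_le hV hx (h.mapsTo_symm _ (hτadm z hz))
    refine smul_mem_posCone (posCone_of_le (smul_mem_posCone hΦx (sub_pos.2 hc1)) ?_)
      (inv_pos.2 (hτ z hz))
    rw [sub_smul, one_smul]
    exact sub_le_sub_left hle _
  have hmono : ∀ y ∈ posCone v, ∀ z ∈ posCone v, y ≤ z ↔ L y ≤ L z := by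
    intro y hy z hz
    obtain ⟨δ, hδ, -, hle⟩ := exists_smul_le hW (Φ x) (h.mapsTo y hy)
    obtain ⟨δ', hδ', -, hle'⟩ := exists_smul_le hW (Φ x) (h.mapsTo z hz)
    obtain ⟨t, ht, hlt⟩ := exists_between (lt_min hδ hδ')
    have ay := h.inv_smul_sub_mem hx hle ht (hlt.trans_le (min_le_left _ _))
    have az := h.inv_smul_sub_mem hx hle' ht (hlt.trans_le (min_le_right _ _))
    have hby := h.mapsTo_symm _ ay
    have hbz := h.mapsTo_symm _ az
    have cy := add_mem_posCone hV hx hby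
    have cz := add_mem_posCone hV hx hbz
    have hit : 0 < t⁻¹ := inv_pos.2 ht
    rw [hL y hy t ht ay, hL z hz t ht az]
    unfold harmonicQuotient
    constructor
    · intro hyz
      refine smul_le_smul_of_nonneg_left (sub_le_sub_left (h.anti _ cy _ cz ?_) _) hit.le
      refine add_le_add_right (h.anti_symm _ az _ ay ?_) _
      exact sub_le_sub_right (smul_le_smul_of_nonneg_left (h.anti _ hy _ hz hyz) hit.le) _
    · intro hyz
      have h₁ := (sub_le_sub_iff_left _).1 (le_of_smul_le_smul_left hyz hit)
      have h₂ := le_of_add_le_add_left (h.le_of_le cy cz h₁)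
      have h₃ := (sub_le_sub_iff_right _).1 (h.symm.le_of_le az ay h₂)
      exact h.le_of_le hy hz (le_of_smul_le_smul_left h₃ hit)
  refine ⟨L, ⟨⟨hmaps, fun y hy z hz hyz => ?_, fun d hd => ?_⟩, fun z hz r hr => ?_, ?_⟩, ?_, ?_⟩
  · exact le_antisymm ((hmono y hy z hz).2 hyz.le) ((hmono z hz y hy).2 hyz.ge)
  · obtain ⟨η, hη, -, hle⟩ := exists_smul_le hW d hΦx
    obtain ⟨δ, hδ, -, hle'⟩ := exists_smul_le hW (Φ x) hd
    have hd' : (η / 2) • d ≤ (2⁻¹ : ℝ) • Φ x := by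
      have := smul_le_smul_of_nonneg_left hle (show (0 : ℝ) ≤ 2⁻¹ by norm_num)
      rwa [smul_smul, inv_mul_eq_div] at this
    have hη2 := half_pos hη
    have e₁ : Φ x - (η / 2) • d ∈ posCone w := by
      refine posCone_of_le (smul_mem_posCone hΦx (show (0 : ℝ) < 2⁻¹ by norm_num)) ?_
      rw [le_sub_comm]
      refine hd'.trans_eq ?_
      module
    have hc : 0 < max (1 - η / 2 * δ) 2⁻¹ := lt_max_of_lt_right (by norm_num)
    have e₂ : Ψ (Φ x - (η / 2) • d) - x ∈ posCone v := by
      refine h.sub_mem_posCone hx e₁ hc (max_lt (by nlinarith) (by norm_num)) ?_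
      have h₁ := smul_le_smul_of_nonneg_left hle' hη2.le
      rw [smul_smul] at h₁
      have h₂ := smul_le_smul_of_nonneg_right (le_max_left (1 - η / 2 * δ) 2⁻¹)
        (nonneg_of_mem_posCone hW hΦx)
      refine le_trans ?_ h₂
      rw [sub_smul, one_smul]
      exact sub_le_sub_left h₁ _
    have e₃ := add_mem_posCone hW hΦx (h.mapsTo _ e₂)
    have e₄ := smul_mem_posCone e₃ hη2
    refine ⟨Ψ ((η / 2) • (Φ x + Φ (Ψ (Φ x - (η / 2) • d) - x))), h.mapsTo_symm _ e₄, ?_⟩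
    rw [hL' _ (h.mapsTo_symm _ e₄) _ e₂ _ hη2 (by
        rw [h.right_inv _ e₄, inv_smul_smul₀ hη2.ne']),
      add_sub_cancel, h.right_inv _ e₁, sub_sub_cancel, inv_smul_smul₀ hη2.ne']
  · have e : (τ z / r)⁻¹ • Φ (r • z) = (τ z)⁻¹ • Φ z := by
      rw [h.smul z hz r hr, smul_smul]
      congr 1
      field_simp
    rw [hL _ (smul_mem_posCone hz hr) _ (div_pos (hτ z hz) hr) (e ▸ hτadm z hz), harmonicQuotient,
      e, inv_div, div_eq_mul_inv, mul_smul]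
    rfl
  · intro y hy z hz
    simpa using hmono y hy z hz
  · rw [hL' x hx x hx 2⁻¹ (by norm_num) (by rw [inv_inv, two_smul]), ← two_smul ℝ x,
      h.smul x hx 2 (by norm_num), inv_inv]
    module
  · intro y hy
    have e := add_mem_posCone hW hΦx (h.mapsTo y hy)
    simpa using hL' _ (h.mapsTo_symm _ e) y hy 1 one_pos (by simp [h.right_inv _ e])

theorem abs_map_add_sub_le (hV : IsOrderUnitSpace V (Ici 0) v)
    (hW : IsOrderUnitSpace W (Ici 0) w) (h : GaugePair v w Φ Ψ) {x : V} (hx : x ∈ posCone v)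
    {A : V →L[ℝ] W} (hA : ∀ a b, a ≤ b → A a ≤ A b) (hAx : A x = Φ x)
    (hHua : ∀ y ∈ posCone v, A (Ψ (Φ x + Φ y)) = Φ x - Φ (x + y)) {u : V} {ε : ℝ} (hε : 0 < ε)
    (hε1 : ε < 1 / 2) (h₁ : -((ε / 2) • x) ≤ u) (h₂ : u ≤ (ε / 2) • x) :
    -((20 * ε ^ 2) • Φ x) ≤ Φ (x + u) - Φ x + A u ∧
      Φ (x + u) - Φ x + A u ≤ (20 * ε ^ 2) • Φ x := by
  have hε' : 0 < 1 - ε := by linarith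
  have hx0 := nonneg_of_mem_posCone hV hx
  have hΦx := h.mapsTo x hx
  set y : V := (1 - ε)⁻¹ • (u + ε • x) with hy_def
  have hyu : (1 - ε) • y = u + ε • x := smul_inv_smul₀ hε'.ne' _
  have hy : y ∈ posCone v := by
    refine smul_mem_posCone (posCone_of_le (smul_mem_posCone hx (half_pos hε)) ?_)
      (inv_pos.2 hε')
    have := add_le_add_left h₁ (ε • x)
    refine le_trans (le_of_eq ?_) this
    module
  have hyx : y ≤ (3 * ε) • x := by
    have e₁ : u + ε • x ≤ (3 / 2 * ε) • x := by
      refine (add_le_add_left h₂ (ε • x)).trans_eq ?_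
      module
    refine (smul_le_smul_of_nonneg_left e₁ (inv_nonneg.2 hε'.le)).trans ?_
    rw [smul_smul]
    refine smul_le_smul_of_nonneg_right ?_ hx0
    rw [inv_mul_le_iff₀ hε']
    nlinarith
  have hΦy := h.mapsTo y hy
  have hsum := add_mem_posCone hW hΦx hΦy
  set z : V := Ψ (Φ x + Φ y) with hz_def
  have hzy : z ≤ y := by
    have := h.anti_symm _ hΦy _ hsum (le_add_of_nonneg_left (nonneg_of_mem_posCone hW hΦx))
    rwa [h.left_inv y hy] at this
  have hyz : y - (9 * ε ^ 2) • x ≤ z := by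
    have e₁ := h.anti y hy _ (smul_mem_posCone hx (by positivity)) hyx
    rw [h.smul x hx _ (by positivity)] at e₁
    have e₂ := smul_le_smul_of_nonneg_left e₁ (show 0 ≤ 3 * ε by positivity)
    rw [smul_inv_smul₀ (by positivity)] at e₂
    have e₃ : Φ x + Φ y ≤ (1 + 3 * ε) • Φ y := by
      rw [add_smul, one_smul, add_comm]
      exact add_le_add_right e₂ _
    have e₄ := h.anti_symm _ hsum _ (smul_mem_posCone hΦy (by positivity)) e₃
    rw [h.symm.smul _ hΦy _ (by positivity), h.left_inv y hy] at e₄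
    refine le_trans ?_ e₄
    have e₅ : (1 - 3 * ε) • y ≤ (1 + 3 * ε)⁻¹ • y := by
      refine smul_le_smul_of_nonneg_right ?_ (nonneg_of_mem_posCone hV hy)
      rw [← one_div, le_div_iff₀ (by positivity)]
      nlinarith
    refine le_trans ?_ e₅
    have e₆ := smul_le_smul_of_nonneg_left hyx (show 0 ≤ 3 * ε by positivity)
    rw [sub_smul, one_smul]
    refine sub_le_sub_left (e₆.trans_eq ?_) y
    module
  have hxu : (1 - ε) • Φ (x + u) = Φ x - A z := by
    have e₁ : x + u = (1 - ε) • (x + y) := by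
      rw [smul_add, hyu]
      module
    rw [hHua y hy, e₁, h.smul _ (add_mem_posCone hV hx hy) _ hε', smul_inv_smul₀ hε'.ne',
      sub_sub_cancel]
  have hAy : (1 - ε) • A y = A u + ε • Φ x := by
    rw [← map_smul, hyu, map_add, map_smul, hAx]
  have b₁ := hA _ _ h₁
  have b₂ := hA _ _ h₂
  have b₃ := hA _ _ hyx
  have b₄ := hA _ _ hzy
  have b₅ := hA _ _ hyz
  simp only [map_neg, map_sub, map_smul, hAx] at b₁ b₂ b₃ b₅
  have b₆ := hA _ _ (nonneg_of_mem_posCone hV hy)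
  rw [map_zero] at b₆
  constructor <;> refine le_of_forall_directedState hW fun ρ hρ => ?_
  all_goals
    have c₁ := hρ.mono b₁
    have c₂ := hρ.mono b₂
    have c₃ := hρ.mono b₃
    have c₄ := hρ.mono b₄
    have c₅ := hρ.mono b₅
    have c₆ := hρ.mono b₆
    have d₁ := congrArg ρ hxu
    have d₂ := congrArg ρ hAy
    have d₃ := hρ.pos hΦx
    simp only [map_neg, map_sub, map_add, map_smul, smul_eq_mul, map_zero] at *
    have d₄ : (1 - ε) * (ρ (Φ (x + u)) - ρ (Φ x) + ρ (A u)) =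
      ρ (A y) - ρ (A z) - ε * ρ (A y) - ε * ρ (A u) := by linarith
    have d₅ : 0 < ε ^ 2 * ρ (Φ x) := by positivity
    have f₁ := mul_le_mul_of_nonneg_left c₁ hε.le
    have f₂ := mul_le_mul_of_nonneg_left c₂ hε.le
    have f₃ := mul_le_mul_of_nonneg_left c₃ hε.le
    have f₆ := mul_nonneg hε.le c₆
    refine le_of_mul_le_mul_left ?_ hε'
    nlinarith

theorem hasFDerivAt (hV : IsOrderUnitSpace V (Ici 0) v)
    (hW : IsOrderUnitSpace W (Ici 0) w) (h : GaugePair v w Φ Ψ) {x : V} (hx : x ∈ posCone v)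
    {A : V →L[ℝ] W} (hA : ∀ a b, a ≤ b → A a ≤ A b) (hAx : A x = Φ x)
    (hHua : ∀ y ∈ posCone v, A (Ψ (Φ x + Φ y)) = Φ x - Φ (x + y)) : HasFDerivAt Φ (-A) x := by
  obtain ⟨δ, hδ, -, hle⟩ := exists_smul_le hV v hx
  have hx0 := nonneg_of_mem_posCone hV hx
  have hnorm : ∀ u : V, ‖u‖ • v ≤ ((2 * δ⁻¹ * ‖u‖) / 2) • x := by
    intro u
    have := smul_le_smul_of_nonneg_left hle (show 0 ≤ δ⁻¹ * ‖u‖ by positivity)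
    refine le_trans (le_of_eq ?_) (this.trans_eq ?_)
    · rw [smul_smul]; congr 1; field_simp
    · congr 1; ring
  rw [hasFDerivAt_iff_isLittleO_nhds_zero]
  have hO : (fun u => Φ (x + u) - Φ x - (-A) u) =O[𝓝 0] fun u : V => ‖u‖ ^ 2 := by
    refine Asymptotics.IsBigO.of_bound (80 * δ⁻¹ ^ 2 * ‖Φ x‖) ?_
    filter_upwards [Metric.ball_mem_nhds (0 : V) (show 0 < δ / 4 by positivity)] with u hu
    rw [mem_ball_zero_iff] at hu
    rcases eq_or_ne u 0 with rfl | hu0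
    · simp
    have hu0 := norm_pos_iff.2 hu0
    have hε1 : 2 * δ⁻¹ * ‖u‖ < 1 / 2 := by
      have : δ⁻¹ * ‖u‖ < 1 / 4 := by rw [inv_mul_lt_iff₀ hδ]; linarith
      linarith
    obtain ⟨h₁, h₂⟩ := h.abs_map_add_sub_le hV hW hx hA hAx hHua (by positivity) hε1
      ((neg_le_neg (hnorm u)).trans (neg_norm_smul_le hV u)) ((le_norm_smul hV u).trans (hnorm u))
    have hΦ := smul_le_smul_of_nonneg_left (le_norm_smul hW (Φ x))
      (show 0 ≤ 20 * (2 * δ⁻¹ * ‖u‖) ^ 2 by positivity)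
    rw [smul_smul] at hΦ
    have := norm_le_of_abs_le hW (by positivity) ((neg_le_neg hΦ).trans h₁) (h₂.trans hΦ)
    rw [neg_apply, sub_neg_eq_add, Real.norm_of_nonneg (by positivity)]
    refine this.trans_eq ?_
    ring
  exact hO.trans_isLittleO (Asymptotics.isLittleO_norm_pow_id one_lt_two)

omit [PosSMulMono ℝ V] [PosSMulMono ℝ W] in
theorem of_gaugeReversing (hΦ : GaugeReversing (Ici 0) v (Ici 0) w Φ) :
    GaugePair v w Φ (Function.invFunOn Φ (posCone v)) := by
  obtain ⟨hbij, hsmul, hle⟩ := hΦ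
  have hinv := hbij.invOn_invFunOn
  have hmaps := hbij.surjOn.mapsTo_invFunOn
  simp only [mem_Ici, sub_nonneg] at hle
  refine ⟨hbij.mapsTo, hmaps, hinv.1, hinv.2, hsmul, fun x hx y hy => (hle x hx y hy).1,
    fun x hx y hy hxy => (hle _ (hmaps hy) _ (hmaps hx)).2 ?_⟩
  rwa [hinv.2 hx, hinv.2 hy]

/-- Hua's identity for gauge-reversing bijections. -/
theorem exists_hasFDerivAt (hV : IsOrderUnitSpace V (Ici 0) v)
    (hW : IsOrderUnitSpace W (Ici 0) w) (h : GaugePair v w Φ Ψ) {x : V} (hx : x ∈ posCone v) :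
    ∃ A : V →L[ℝ] W, HasFDerivAt Φ A x ∧
      ∀ y ∈ posCone v, Φ x - Φ (x + y) = -A (Ψ (Φ x + Φ y)) := by
  obtain ⟨L, hL, hLx, hHua⟩ := h.exists_gaugePreserving hV hW hx
  obtain ⟨A, hA⟩ := GaugePreserving.exists_continuousLinearMap hV hW hL
  have hAHua : ∀ y ∈ posCone v, A (Ψ (Φ x + Φ y)) = Φ x - Φ (x + y) := fun y hy => by
    rw [hA _ (h.mapsTo_symm _ (add_mem_posCone hW (h.mapsTo x hx) (h.mapsTo y hy))), hHua y hy]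
  have hmono : ∀ a b, a ≤ b → A a ≤ A b := by
    intro a b hab
    have ha : a + (‖a‖ + 1) • v ∈ posCone v := ⟨1, one_pos, by
      have := neg_le_iff_add_nonneg.1 (neg_norm_smul_le hV a)
      rw [mem_Ici]; convert this using 1; module⟩
    have hle := add_le_add_left hab ((‖a‖ + 1) • v)
    have hb := posCone_of_le ha hle
    have := (GaugePreserving.le_iff hL ha hb).2 hle
    rwa [← hA _ ha, ← hA _ hb, map_add, map_add, add_le_add_iff_right] at this
  refine ⟨-A, h.hasFDerivAt hV hW hx hmono ((hA x hx).trans hLx) hAHua, fun y hy => ?_⟩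
  rw [neg_apply, neg_neg, hAHua y hy]

end GaugePair

end Derivative

/-- The partial order whose cone of nonnegative elements is `P`. -/
abbrev partialOrderOfCone {V : Type*} [NormedAddCommGroup V] [NormedSpace ℝ V]
    {P : Set V} {v : V} (hV : IsOrderUnitSpace V P v) : PartialOrder V where
  le x y := y - x ∈ P
  le_refl x := by simpa using hV.smul_mem 0 le_rfl v hV.unit_mem
  le_trans x y z hxy hyz := by simpa using hV.add_mem _ hyz _ hxy
  le_antisymm x y hxy hyx := by
    rw [← sub_eq_zero]
    exact hV.proper _ hyx (by rwa [neg_sub])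

section PartialOrderOfCone

variable {V : Type*} [NormedAddCommGroup V] [NormedSpace ℝ V] {P : Set V} {v : V}

theorem isOrderedAddMonoid_of_cone (hV : IsOrderUnitSpace V P v) :
    letI := partialOrderOfCone hV; IsOrderedAddMonoid V :=
  letI := partialOrderOfCone hV
  { add_le_add_left := fun x y hxy z => show y + z - (x + z) ∈ P by
      rw [add_sub_add_right_eq_sub]; exact hxy }

theorem posSMulMono_of_cone (hV : IsOrderUnitSpace V P v) :
    letI := partialOrderOfCone hV; PosSMulMono ℝ V :=
  letI := partialOrderOfCone hV
  { smul_le_smul_of_nonneg_left := fun r hr x y hxy => show r • y - r • x ∈ P by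
      rw [← smul_sub]; exact hV.smul_mem r hr _ hxy }

theorem cone_eq_Ici (hV : IsOrderUnitSpace V P v) :
    letI := partialOrderOfCone hV; P = Ici 0 :=
  Set.ext fun x => show x ∈ P ↔ x - 0 ∈ P by rw [sub_zero]

end PartialOrderOfCone

end OrderUnit

/-- (Hua's identity.) Let `Φ` be a gauge-reversing bijection between
the open cones `C` and `D` of two complete order unit spaces. Then `Φ` is Fréchet
differentiable at each point `x ∈ C`, and for all `x, y ∈ C` one has
`Φ(x) + Φ(y) ∈ D` and `Φ(x) − Φ(x+y) = −DΦ(x)(Φ⁻¹(Φ(x) + Φ(y)))`. -/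
theorem gaugeReversing_hua_identity
    {V : Type*} [NormedAddCommGroup V] [NormedSpace ℝ V] [CompleteSpace V]
    {W : Type*} [NormedAddCommGroup W] [NormedSpace ℝ W] [CompleteSpace W]
    (P : Set V) (v : V) (Q : Set W) (w : W)
    (hV : IsOrderUnitSpace V P v) (hW : IsOrderUnitSpace W Q w)
    (Φ : V → W) (hΦ : GaugeReversing P v Q w Φ) :
    ∀ x ∈ openCone P v, ∃ A : V →L[ℝ] W, HasFDerivAt Φ A x ∧
      ∀ y ∈ openCone P v, Φ x + Φ y ∈ openCone Q w ∧
        Φ x - Φ (x + y) =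
          -(A (Function.invFunOn Φ (openCone P v) (Φ x + Φ y))) := by
  let := OrderUnit.partialOrderOfCone hV
  let := OrderUnit.partialOrderOfCone hW
  have := OrderUnit.isOrderedAddMonoid_of_cone hV
  have := OrderUnit.isOrderedAddMonoid_of_cone hW
  have := OrderUnit.posSMulMono_of_cone hV
  have := OrderUnit.posSMulMono_of_cone hW
  have hP := OrderUnit.cone_eq_Ici hV
  have hQ := OrderUnit.cone_eq_Ici hW
  have hV' : IsOrderUnitSpace V (Set.Ici 0) v := by rwa [← hP]
  have hW' : IsOrderUnitSpace W (Set.Ici 0) w := by rwa [← hQ]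
  have h := OrderUnit.GaugePair.of_gaugeReversing (Φ := Φ) (v := v) (w := w) (by rwa [← hP, ← hQ])
  rw [hP, hQ]
  intro x hx
  obtain ⟨A, hA, hHua⟩ := h.exists_hasFDerivAt hV' hW' hx
  exact ⟨A, hA, fun y hy =>
    ⟨OrderUnit.add_mem_posCone hW' (h.mapsTo x hx) (h.mapsTo y hy), hHua y hy⟩⟩
end
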